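/- arXiv:1708.06461 — 8 statements merged into one kernel-verified Lean document; each statement's English description precedes it below -/
import Mathlib

section
/- If w is a partial word of length greater than one containing at least one hole, over a nonempty alphabet Σ, then w has an abelian border, i.e., there exists k with 1 ≤ k ≤ |w|−1 such that the prefix of w of length k is abelian compatible with the suffix of w of length k. -/
/-- A partial word over alphabet `α` is a list over `Option α`; `none` is a hole. -/
abbrev PWord (α : Type*) := List (Option α)

/-- `c` is a completion of the partial word `w`: a total word of the same length
agreeing with `w` on every non-hole position. -/
def IsCompletion {α : Type*} (w : PWord α) (c : List α) : Prop :=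
  List.Forall₂ (fun o a => ∀ x, o = some x → x = a) w c

/-- Two partial words are abelian compatible if they admit completions that are
permutations of one another (abelian equivalent). -/
def AbelianCompat {α : Type*} (u v : PWord α) : Prop :=
  ∃ cu cv, IsCompletion u cu ∧ IsCompletion v cv ∧ cu.Perm cv

/-- A partial word `w` has an abelian border of length `k`, `1 ≤ k ≤ |w| - 1`, if
its prefix of length `k` is abelian compatible with its suffix of length `k`. -/
def HasAbelianBorder {α : Type*} (w : PWord α) (k : ℕ) : Prop :=
  1 ≤ k ∧ k ≤ w.length - 1 ∧ AbelianCompat (w.take k) (w.drop (w.length - k))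

/-- A total word `w` has an abelian border of length `k`, `1 ≤ k ≤ |w| - 1`, if
its prefix of length `k` is a permutation of its suffix of length `k`. -/
def HasAbelianBorderT {α : Type*} (w : List α) (k : ℕ) : Prop :=
  1 ≤ k ∧ k ≤ w.length - 1 ∧ (w.take k).Perm (w.drop (w.length - k))

theorem isCompletion_map_getD {α : Type*} (d : α) (w : PWord α) :
    IsCompletion w (w.map (·.getD d)) := by
  unfold IsCompletion
  induction w with
  | nil => exact .nil
  | cons o w ih => exact .cons (by rintro x rfl; rfl) ih

theorem IsCompletion.append {α : Type*} {u v : PWord α} {c d : List α}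
    (hu : IsCompletion u c) (hv : IsCompletion v d) : IsCompletion (u ++ v) (c ++ d) :=
  List.rel_append hu hv

theorem isCompletion_none {α : Type*} (a : α) : IsCompletion [none] [a] :=
  .cons (by simp) .nil

theorem isCompletion_singleton_getD {α : Type*} (d : α) (o : Option α) :
    IsCompletion [o] [o.getD d] :=
  isCompletion_map_getD d [o]

/-- Removing the last letter and removing the first letter of a word with a hole yields abelian
compatible words. -/
theorem abelianCompat_cons_append_singleton {α : Type*} [Nonempty α] (x y : Option α)
    (m : PWord α) (h : none ∈ [x] ++ m ++ [y]) : AbelianCompat ([x] ++ m) (m ++ [y]) := by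
  obtain ⟨d⟩ := ‹Nonempty α›
  have hole : x = none ∨ y = none ∨ none ∈ m := by
    simp only [List.mem_append, List.mem_singleton] at h
    tauto
  rcases hole with rfl | rfl | hm
  · exact ⟨_, _, (isCompletion_none (y.getD d)).append (isCompletion_map_getD d m),
      (isCompletion_map_getD d m).append (isCompletion_singleton_getD d y), List.perm_append_comm⟩
  · exact ⟨_, _, (isCompletion_singleton_getD d x).append (isCompletion_map_getD d m),
      (isCompletion_map_getD d m).append (isCompletion_none (x.getD d)), List.perm_append_comm⟩
  · obtain ⟨s, t, rfl⟩ := List.append_of_mem hm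
    have fill (a : α) : IsCompletion (s ++ none :: t)
        (s.map (·.getD d) ++ ([a] ++ t.map (·.getD d))) :=
      (isCompletion_map_getD d s).append
        ((isCompletion_none a).append (isCompletion_map_getD d t))
    refine ⟨_, _, (isCompletion_singleton_getD d x).append (fill (y.getD d)),
      (fill (x.getD d)).append (isCompletion_singleton_getD d y), ?_⟩
    classical
    rw [List.perm_iff_count]
    intro a
    simp only [List.count_append]
    omega

/-- If `w` is a partial word of length greater than one containing at least one hole,
over a nonempty alphabet, then `w` has an abelian border. -/
theorem stmt_0 {α : Type*} [Nonempty α] (w : PWord α)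
    (hlen : 1 < w.length) (hhole : 0 < w.countP (·.isNone)) :
    ∃ k, HasAbelianBorder w k := by
  refine ⟨w.length - 1, by omega, le_rfl, ?_⟩
  have hmem : none ∈ w := by
    obtain ⟨o, ho, hn⟩ := List.countP_pos_iff.mp hhole
    rwa [Option.isNone_iff_eq_none.mp hn] at ho
  obtain ⟨x, m, y, rfl⟩ : ∃ x m y, w = [x] ++ m ++ [y] := by
    match w, hlen with
    | x :: z :: l, _ =>
      obtain ⟨m, y, hm⟩ := List.eq_nil_or_concat (z :: l) |>.resolve_left (by simp)
      exact ⟨x, m, y, by simp [hm]⟩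
  convert abelianCompat_cons_append_singleton x y m hmem using 1
  · simp
  · simp
end

section
/- Let w be a partial word over {0,1} of length n ≥ 2 that has at least one abelian border. Then the minimal abelian border length of w equals the minimum of the set of all k with 1 ≤ k ≤ n−1 for which there exists a completion c of w² (the concatenation of w with itself) such that the Z_k-form Z_k(c) is Dyckian. -/
/-- A Dyck word: a binary word with equally many `0`s and `1`s in which no prefix
contains more `1`s than `0`s. -/
def IsDyck (v : List (Fin 2)) : Prop :=
  v.count 0 = v.count 1 ∧ ∀ p, p <+: v → p.count 1 ≤ p.count 0

/-- A binary word is Dyckian if it or its bitwise negation is a Dyck word. -/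
def Dyckian (v : List (Fin 2)) : Prop :=
  IsDyck v ∨ IsDyck (v.map fun x => if x = 0 then 1 else 0)

/-- The `Z_k`-form of a binary total word `v` of length `N`: from the word
`y` of length `k` with `y[i] = 0` if `v[i] = 0 ∧ v[N-1-i] = 1`, `y[i] = 1` if
`v[i] = 1 ∧ v[N-1-i] = 0`, and `y[i] = 2` if `v[i] = v[N-1-i]`, delete the `2`s. -/
def Zform (v : List (Fin 2)) (k : ℕ) : List (Fin 2) :=
  (List.range k).filterMap fun i =>
    if v.getD i 0 = v.getD (v.length - 1 - i) 0 then none else some (v.getD i 0)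

theorem exists_isCompletion {α : Type*} [Inhabited α] (w : PWord α) :
    ∃ c, IsCompletion w c := by
  induction w with
  | nil => exact ⟨[], .nil⟩
  | cons o w ih =>
    obtain ⟨c, hc⟩ := ih
    exact ⟨o.getD default :: c, .cons (by rintro x rfl; rfl) hc⟩

theorem perm_iff_count_zero {u v : List (Fin 2)} (h : u.length = v.length) :
    u.Perm v ↔ u.count 0 = v.count 0 := by
  have key : ∀ l : List (Fin 2), l.count 0 + l.count 1 = l.length := by
    intro l
    induction l with
    | nil => rfl
    | cons a l ih => fin_cases a <;> simp <;> omega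
  refine ⟨fun hp => hp.count_eq 0, fun h0 => List.perm_iff_count.2 fun a => ?_⟩
  have hu := key u
  have hv := key v
  fin_cases a
  · exact h0
  · change u.count 1 = v.count 1
    omega

theorem count_map_neg (l : List (Fin 2)) :
    (l.map fun x => if x = 0 then (1 : Fin 2) else 0).count 0 = l.count 1 ∧
      (l.map fun x => if x = 0 then (1 : Fin 2) else 0).count 1 = l.count 0 := by
  induction l with
  | nil => simp
  | cons a l ih => fin_cases a <;> simp_all

theorem Zform_succ (c : List (Fin 2)) (j : ℕ) :
    Zform c (j + 1) = Zform c j ++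
      if c.getD j 0 = c.getD (c.length - 1 - j) 0 then [] else [c.getD j 0] := by
  unfold Zform
  rw [List.range_succ, List.filterMap_append]
  congr 1
  split_ifs with h <;> simp only [List.filterMap_cons, List.filterMap_nil, h, if_true, if_false]

theorem prefix_Zform {c p : List (Fin 2)} {k : ℕ} (h : p <+: Zform c k) :
    ∃ j ≤ k, p = Zform c j := by
  obtain ⟨l, hl, rfl⟩ := List.prefix_filterMap_iff.1 h
  rw [List.prefix_iff_eq_take, List.take_range] at hl
  exact ⟨_, min_le_right _ _, by rw [hl]; rfl⟩

/-- The imbalance of the `Z_j`-form compares the number of zeros in the prefix and the suffix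
of length `j`. -/
theorem count_Zform (v : List (Fin 2)) (j : ℕ) (hj : j ≤ v.length) :
    (Zform v j).count 0 + (v.drop (v.length - j)).count 0 =
      (Zform v j).count 1 + (v.take j).count 0 := by
  induction j with
  | zero => simp [Zform]
  | succ j ih =>
    have ih := ih (by omega)
    have hd : v.drop (v.length - (j + 1)) =
        v[v.length - 1 - j] :: v.drop (v.length - j) := by
      rw [List.drop_eq_getElem_cons (by omega)]
      congr 2 <;> omega
    rw [hd, Zform_succ, List.take_succ_eq_append_getElem (by omega),
      List.getD_eq_getElem _ _ (by omega : j < v.length),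
      List.getD_eq_getElem _ _ (by omega : v.length - 1 - j < v.length)]
    generalize v[j] = a
    generalize v[v.length - 1 - j] = b
    fin_cases a <;> fin_cases b <;> simp <;> omega

theorem perm_iff_count_Zform (c : List (Fin 2)) (j : ℕ) (hj : j ≤ c.length) :
    (c.take j).Perm (c.drop (c.length - j)) ↔ (Zform c j).count 0 = (Zform c j).count 1 := by
  rw [perm_iff_count_zero (by simp; omega)]
  have := count_Zform c j hj
  omega

theorem Dyckian.count_eq {v : List (Fin 2)} (h : Dyckian v) : v.count 0 = v.count 1 := by
  rcases h with h | h
  · exact h.1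
  · have := h.1
    rw [(count_map_neg v).1, (count_map_neg v).2] at this
    exact this.symm

theorem hasAbelianBorder_of_count_eq {w : PWord (Fin 2)} {c : List (Fin 2)} {k : ℕ}
    (h1 : 1 ≤ k) (hk : k ≤ w.length - 1) (hc : IsCompletion (w ++ w) c)
    (h : (Zform c k).count 0 = (Zform c k).count 1) : HasAbelianBorder w k := by
  have hlen : w.length + w.length = c.length := by simpa using List.Forall₂.length_eq hc
  refine ⟨h1, hk, c.take k, c.drop (c.length - k), ?_, ?_,
    (perm_iff_count_Zform c k (by omega)).2 h⟩
  · have := List.forall₂_take k hc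
    rwa [List.take_append_of_le_length (by omega)] at this
  · have := List.forall₂_drop (c.length - k) hc
    rw [List.drop_append, List.drop_eq_nil_of_le (by omega), List.nil_append] at this
    rwa [show c.length - k - w.length = w.length - k by omega] at this

theorem HasAbelianBorder.exists_completion {w : PWord (Fin 2)} {k : ℕ}
    (h : HasAbelianBorder w k) :
    ∃ c, IsCompletion (w ++ w) c ∧ (Zform c k).count 0 = (Zform c k).count 1 := by
  obtain ⟨h1, hk, u, v, hu, hv, hp⟩ := h
  obtain ⟨x, hx⟩ := exists_isCompletion (w.drop k)
  obtain ⟨y, hy⟩ := exists_isCompletion (w.take (w.length - k))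
  have hul : k = u.length := by
    have := List.Forall₂.length_eq hu
    rw [List.length_take] at this
    omega
  have hvl : k = v.length := by rw [hul, hp.length_eq]
  refine ⟨(u ++ x) ++ (y ++ v), ?_, ?_⟩
  · have h1 := List.rel_append hu hx
    have h2 := List.rel_append hy hv
    simp only [List.take_append_drop] at h1 h2
    exact List.rel_append h1 h2
  · rw [← perm_iff_count_Zform _ _ (by simp; omega)]
    have e1 : ((u ++ x) ++ (y ++ v)).take k = u := by
      rw [List.append_assoc, hul, List.take_left]
    have e2 : ((u ++ x) ++ (y ++ v)).drop (((u ++ x) ++ (y ++ v)).length - k) = v := by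
      rw [← List.append_assoc]
      exact List.drop_left' (by simp; omega)
    rwa [e1, e2]

/-- A walk with steps of size at most one that avoids zero strictly between its end points,
where it vanishes, keeps a constant sign. -/
theorem nonneg_or_nonpos_of_steps (f : ℕ → ℤ) (k : ℕ) (h0 : f 0 = 0) (hk : f k = 0)
    (hs : ∀ j < k, |f (j + 1) - f j| ≤ 1) (hne : ∀ j, 1 ≤ j → j < k → f j ≠ 0) :
    (∀ j ≤ k, 0 ≤ f j) ∨ (∀ j ≤ k, f j ≤ 0) := by
  have pos : ∀ g : ℕ → ℤ, g 0 = 0 → g k = 0 → (∀ j < k, |g (j + 1) - g j| ≤ 1) →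
      (∀ j, 1 ≤ j → j < k → g j ≠ 0) → 0 ≤ g 1 → ∀ j ≤ k, 0 ≤ g j := by
    intro g g0 gk gs gne g1 j hj
    induction j with
    | zero => exact g0.ge
    | succ j ih =>
      rcases Nat.eq_zero_or_pos j with rfl | hpos
      · exact g1
      · have := ih (by omega)
        have := gne j hpos (by omega)
        have := abs_le.1 (gs j (by omega))
        omega
  rcases le_total 0 (f 1) with h | h
  · exact .inl (pos f h0 hk hs hne h)
  · refine .inr fun j hj => ?_
    have := pos (fun i => -f i) (by simp [h0]) (by simp [hk])
      (fun j hj => by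
        rw [show -f (j + 1) - -f j = -(f (j + 1) - f j) by ring, abs_neg]
        exact hs j hj)
      (fun j h1 h2 => by simpa using hne j h1 h2) (by simpa using h) j hj
    simpa using this

theorem dyckian_Zform_of_ne {c : List (Fin 2)} {k : ℕ}
    (hk : (Zform c k).count 0 = (Zform c k).count 1)
    (hne : ∀ j, 1 ≤ j → j < k → (Zform c j).count 0 ≠ (Zform c j).count 1) :
    Dyckian (Zform c k) := by
  have key := nonneg_or_nonpos_of_steps
    (fun j => ((Zform c j).count 0 : ℤ) - (Zform c j).count 1) k (by simp [Zform])
    (by simp [hk])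
    (fun j _ => by
      simp only [Zform_succ]
      generalize c.getD j 0 = a
      split_ifs
      · simp
      · rw [abs_le]
        fin_cases a <;> simp)
    (fun j h1 h2 => by
      have := hne j h1 h2
      omega)
  rcases key with h | h
  · refine .inl ⟨hk, fun p hp => ?_⟩
    obtain ⟨j, hj, rfl⟩ := prefix_Zform hp
    have := h j hj
    omega
  · refine .inr ⟨?_, fun p hp => ?_⟩
    · rw [(count_map_neg _).1, (count_map_neg _).2, hk]
    · obtain ⟨q, hq, rfl⟩ := List.prefix_map_iff.1 hp
      obtain ⟨j, hj, rfl⟩ := prefix_Zform hq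
      rw [(count_map_neg _).1, (count_map_neg _).2]
      have := h j hj
      omega

/-- For a binary partial word `w` of length `n ≥ 2` with at least one abelian border,
the minimal abelian border length of `w` is the minimum of all `k`, `1 ≤ k ≤ n - 1`,
such that some completion `c` of `w²` has `Z_k(c)` Dyckian. -/
theorem stmt_2 (w : PWord (Fin 2)) (hn : 2 ≤ w.length)
    (hb : ∃ k, HasAbelianBorder w k) :
    IsLeast {k | HasAbelianBorder w k}
      (sInf {k | 1 ≤ k ∧ k ≤ w.length - 1 ∧
        ∃ c, IsCompletion (w ++ w) c ∧ Dyckian (Zform c k)}) := by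
  classical
  set S := {k | 1 ≤ k ∧ k ≤ w.length - 1 ∧
    ∃ c, IsCompletion (w ++ w) c ∧ Dyckian (Zform c k)}
  have hS : ∀ k ∈ S, HasAbelianBorder w k := fun k ⟨h1, hk, c, hc, hd⟩ =>
    hasAbelianBorder_of_count_eq h1 hk hc hd.count_eq
  have hmin := Nat.find_spec hb
  have hmem : Nat.find hb ∈ S := by
    obtain ⟨c, hc, he⟩ := hmin.exists_completion
    refine ⟨hmin.1, hmin.2.1, c, hc, dyckian_Zform_of_ne he fun j h1 hj hcount => ?_⟩
    exact Nat.find_min hb hj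
      (hasAbelianBorder_of_count_eq h1 (hj.le.trans hmin.2.1) hc hcount)
  exact ⟨hS _ (Nat.sInf_mem ⟨_, hmem⟩), fun k hk =>
    (Nat.sInf_le hmem).trans (Nat.find_min' hb hk)⟩
end

section
/- For all n and k with 1 ≤ k ≤ ⌊n/2⌋, the number of binary total words of length n whose minimal abelian border length equals k is 2^{n−2k+1} · C_{k−1}, where C_j denotes the j-th Catalan number. -/
open DyckStep

/-- The letter coding a step: `1` for an up step and `0` for a down step. -/
def stepBit : DyckStep → Fin 2
  | U => 1
  | D => 0

/-- The opposite step. -/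
def flipStep : DyckStep → DyckStep
  | U => D
  | D => U

/-- Wrap pairs of steps around the word `m`, outermost pair first: the first step of each pair
contributes its letter on the left, the second step the letter of its opposite on the right. -/
def wrapSteps : List DyckStep → List (Fin 2) → List (Fin 2)
  | x :: y :: p, m => stepBit x :: (wrapSteps p m ++ [stepBit (flipStep y)])
  | _, m => m

/-- The walk `p` of length `2 * k` returns to its starting height for the first time at its end. -/
def IsFirstReturn (k : ℕ) (p : List DyckStep) : Prop :=
  p.length = 2 * k ∧ ∀ j, 1 ≤ j → j ≤ k → ((p.take (2 * j)).count U = j ↔ j = k)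

lemma flipStep_flipStep (x : DyckStep) : flipStep (flipStep x) = x := by
  cases x <;> rfl

lemma stepBit_injective : Function.Injective stepBit := by
  intro x y h
  cases x <;> cases y <;> simp_all [stepBit]

lemma stepBit_surjective : Function.Surjective stepBit := by
  intro a
  fin_cases a
  exacts [⟨D, rfl⟩, ⟨U, rfl⟩]

lemma flipStep_injective : Function.Injective flipStep :=
  Function.LeftInverse.injective flipStep_flipStep

lemma exists_cons_cons_of_length {α : Type*} {p : List α} {k : ℕ}
    (hp : p.length = 2 * (k + 1)) : ∃ x y q, p = x :: y :: q ∧ q.length = 2 * k := by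
  match p, hp with
  | x :: y :: q, hp => exact ⟨x, y, q, rfl, by simp at hp; omega⟩

lemma length_wrapSteps {k : ℕ} {p : List DyckStep} (hp : p.length = 2 * k)
    (m : List (Fin 2)) : (wrapSteps p m).length = 2 * k + m.length := by
  induction k generalizing p with
  | zero => simp_all [wrapSteps]
  | succ k ih =>
    obtain ⟨x, y, q, rfl, hq⟩ := exists_cons_cons_of_length hp
    simp only [wrapSteps, List.length_cons, List.length_append, List.length_nil, ih hq]
    omega

lemma wrapSteps_inj {k : ℕ} {p q : List DyckStep} {m m' : List (Fin 2)}
    (hp : p.length = 2 * k) (hq : q.length = 2 * k) (h : wrapSteps p m = wrapSteps q m') :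
    p = q ∧ m = m' := by
  induction k generalizing p q with
  | zero => simp_all [wrapSteps]
  | succ k ih =>
    obtain ⟨x, y, p, rfl, hp'⟩ := exists_cons_cons_of_length hp
    obtain ⟨x', y', q, rfl, hq'⟩ := exists_cons_cons_of_length hq
    simp only [wrapSteps, List.cons.injEq] at h
    obtain ⟨h₁, h₂⟩ := h
    obtain ⟨h₂, h₃⟩ := List.append_inj' h₂ rfl
    obtain ⟨rfl, rfl⟩ := ih hp' hq' h₂
    simp only [List.cons.injEq, and_true] at h₃
    simp [stepBit_injective h₁, flipStep_injective (stepBit_injective h₃)]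

lemma exists_wrapSteps_eq (k : ℕ) (w : List (Fin 2)) (hw : 2 * k ≤ w.length) :
    ∃ p m, p.length = 2 * k ∧ wrapSteps p m = w := by
  induction k generalizing w with
  | zero => exact ⟨[], w, rfl, rfl⟩
  | succ k ih =>
    match w, hw with
    | a :: v, hw =>
      simp only [List.length_cons] at hw
      rcases List.eq_nil_or_concat v with rfl | ⟨v, b, rfl⟩
      · simp at hw
        omega
      · obtain ⟨p, m, hp, rfl⟩ := ih v (by simp at hw; omega)
        obtain ⟨x, rfl⟩ := stepBit_surjective a
        obtain ⟨y, rfl⟩ := stepBit_surjective b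
        refine ⟨x :: flipStep y :: p, m, by simp [hp]; ring, ?_⟩
        simp [wrapSteps, flipStep_flipStep]

lemma count_take_wrapSteps {k j : ℕ} {p : List DyckStep} (hp : p.length = 2 * k) (hj : j ≤ k)
    (m : List (Fin 2)) :
    ((wrapSteps p m).take j).count 1 + j =
      ((wrapSteps p m).drop ((wrapSteps p m).length - j)).count 1 + (p.take (2 * j)).count U := by
  induction k generalizing p j with
  | zero => simp_all
  | succ k ih =>
    cases j with
    | zero => simp
    | succ j =>
      obtain ⟨x, y, q, rfl, hq⟩ := exists_cons_cons_of_length hp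
      have hlen := length_wrapSteps hq m
      have h := ih hq (show j ≤ k by omega)
      have e : (stepBit x :: (wrapSteps q m ++ [stepBit (flipStep y)])).length - (j + 1) =
          ((wrapSteps q m).length - j) + 1 := by simp; omega
      simp only [wrapSteps]
      rw [e, List.drop_succ_cons, List.take_succ_cons,
        List.take_append_of_le_length (by omega), List.drop_append_of_le_length (by omega),
        show 2 * (j + 1) = 2 * j + 1 + 1 by ring, List.take_succ_cons, List.take_succ_cons]
      cases x <;> cases y <;> simp [stepBit, flipStep] <;> omega

lemma perm_iff_count_one {u v : List (Fin 2)} (h : u.length = v.length) :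
    u.Perm v ↔ u.count 1 = v.count 1 := by
  have key (l : List (Fin 2)) : l.count 0 + l.count 1 = l.length := by
    induction l with
    | nil => rfl
    | cons a l ih => fin_cases a <;> simp <;> omega
  refine ⟨fun h => h.count_eq 1, fun h₁ => List.perm_iff_count.2 fun a => ?_⟩
  have hu := key u
  have hv := key v
  fin_cases a <;> simp <;> omega

lemma isLeast_border_wrapSteps_iff {n k : ℕ} (hk1 : 1 ≤ k) {p : List DyckStep}
    (hp : p.length = 2 * k) {m : List (Fin 2)} (hn : (wrapSteps p m).length = n) :
    IsLeast {j | HasAbelianBorderT (wrapSteps p m) j} k ↔ IsFirstReturn k p := by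
  have hlen := length_wrapSteps hp m
  have key : ∀ j, 1 ≤ j → j ≤ k →
      (HasAbelianBorderT (wrapSteps p m) j ↔ (p.take (2 * j)).count U = j) := by
    intro j h1 hj
    have hc := count_take_wrapSteps hp hj m
    rw [HasAbelianBorderT, perm_iff_count_one (by simp; omega)]
    omega
  constructor
  · rintro ⟨h₁, h₂⟩
    refine ⟨hp, fun j h1 hj => ?_⟩
    rw [← key j h1 hj]
    exact ⟨fun h => le_antisymm hj (h₂ h), fun h => h ▸ h₁⟩
  · rintro ⟨-, h⟩
    refine ⟨(key k hk1 le_rfl).2 ((h k hk1 le_rfl).2 rfl), fun j hj => ?_⟩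
    by_contra! hlt
    have := (h j hj.1 hlt.le).1 ((key j hj.1 hlt.le).1 hj)
    omega

lemma count_U_add_count_D (l : List DyckStep) : l.count U + l.count D = l.length := by
  induction l with
  | nil => rfl
  | cons a l ih => cases a <;> simp <;> omega

lemma count_U_map_flipStep (l : List DyckStep) : (l.map flipStep).count U = l.count D := by
  induction l with
  | nil => rfl
  | cons a l ih => cases a <;> simp [flipStep, ih]

lemma IsFirstReturn.map_flipStep {k : ℕ} {p : List DyckStep} (h : IsFirstReturn k p) :
    IsFirstReturn k (p.map flipStep) := by
  refine ⟨by simp [h.1], fun j h1 hj => ?_⟩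
  rw [← h.2 j h1 hj, ← List.map_take, count_U_map_flipStep]
  have := count_U_add_count_D (p.take (2 * j))
  rw [List.length_take, h.1] at this
  omega

lemma DyckWord.length_toList (q : DyckWord) : q.toList.length = 2 * q.semilength := by
  have := count_U_add_count_D q.toList
  have := q.count_U_eq_count_D
  rw [DyckWord.semilength]
  omega

lemma DyckWord.IsNested.isFirstReturn {q : DyckWord} (h : q.IsNested) :
    IsFirstReturn q.semilength q.toList := by
  refine ⟨q.length_toList, fun j h1 hj => ?_⟩
  have hl := q.length_toList
  have hc := count_U_add_count_D (q.toList.take (2 * j))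
  rw [List.length_take] at hc
  constructor
  · intro hU
    by_contra hne
    have := h.2 (show 0 < 2 * j by omega) (by omega)
    omega
  · rintro rfl
    rw [List.take_of_length_le (by omega)]
    rfl

lemma IsFirstReturn.count_D_lt_count_U {k : ℕ} {p : List DyckStep}
    (h : IsFirstReturn k (U :: p)) {i : ℕ} (hi : i + 1 < 2 * k) :
    ((U :: p).take (i + 1)).count D < ((U :: p).take (i + 1)).count U := by
  induction i with
  | zero => simp
  | succ i ih =>
    specialize ih (by omega)
    have hlen := h.1
    have c := count_U_add_count_D ((U :: p).take (i + 1 + 1))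
    rw [List.length_take] at c
    have hr : ∀ j, 2 * j = i + 1 + 1 → ((U :: p).take (i + 1 + 1)).count U ≠ j := by
      intro j hj hU
      have := (h.2 j (by omega) (by omega)).1 (by rw [hj, hU])
      omega
    have e : (U :: p).take (i + 1 + 1) = (U :: p).take (i + 1) ++ [(U :: p)[i + 1]] :=
      (List.take_append_getElem (by omega)).symm
    have hle : ((U :: p).take (i + 1 + 1)).count D ≤ ((U :: p).take (i + 1 + 1)).count U := by
      rw [e, List.count_append, List.count_append]
      have : List.count D [(U :: p)[i + 1]] ≤ 1 := List.count_le_length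
      omega
    by_contra hge
    exact hr _ (by omega) rfl

lemma IsFirstReturn.exists_nest {k : ℕ} {p : List DyckStep} (h : IsFirstReturn k (U :: p)) :
    ∃ q : DyckWord, q.semilength + 1 = k ∧ q.nest.toList = U :: p := by
  have hlen := h.1
  have hk : 1 ≤ k := by
    simp at hlen
    omega
  have hU : (U :: p).count U = k := by
    have := (h.2 k hk le_rfl).2 rfl
    rwa [List.take_of_length_le hlen.le] at this
  have hc := count_U_add_count_D (U :: p)
  let r : DyckWord := ⟨U :: p, by omega, fun i => by
    rcases i with - | i
    · simp
    · rcases lt_or_ge (i + 1) (2 * k) with hi | hi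
      · exact (h.count_D_lt_count_U hi).le
      · rw [List.take_of_length_le (by omega)]
        omega⟩
  have hr : r.IsNested := by
    refine ⟨DyckWord.toList_ne_nil.1 (by simp [r]), fun i h0 hi => ?_⟩
    obtain ⟨i, rfl⟩ := Nat.exists_eq_succ_of_ne_zero h0.ne'
    exact h.count_D_lt_count_U (by simpa [r, ← hlen] using hi)
  refine ⟨r.denest hr, ?_, by rw [DyckWord.nest_denest]⟩
  rw [← DyckWord.semilength_nest, DyckWord.nest_denest]
  exact hU

lemma card_isFirstReturn {k : ℕ} (hk : 1 ≤ k) :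
    Nat.card {p : List DyckStep // IsFirstReturn k p} = 2 * catalan (k - 1) := by
  have hnest (q : DyckWord) (hq : q.semilength = k - 1) : IsFirstReturn k q.nest.toList := by
    have := (DyckWord.IsNested.nest (p := q)).isFirstReturn
    rwa [DyckWord.semilength_nest, hq, Nat.sub_add_cancel hk] at this
  let f : {q : DyckWord // q.semilength = k - 1} ⊕ {q : DyckWord // q.semilength = k - 1} →
      {p : List DyckStep // IsFirstReturn k p} :=
    Sum.elim (fun q => ⟨q.1.nest.toList, hnest q.1 q.2⟩)
      (fun q => ⟨q.1.nest.toList.map flipStep, (hnest q.1 q.2).map_flipStep⟩)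
  have hinj {q r : DyckWord} (h : q.nest.toList = r.nest.toList) : q = r := by
    simpa [DyckWord.nest, DyckWord.ext_iff] using h
  have hf : Function.Bijective f := by
    constructor
    · rintro (⟨q, hq⟩ | ⟨q, hq⟩) (⟨r, hr⟩ | ⟨r, hr⟩) h <;> simp only [f, Sum.elim_inl,
        Sum.elim_inr, Subtype.mk.injEq] at h
      · simp [hinj h]
      · simp [DyckWord.nest, flipStep] at h
      · simp [DyckWord.nest, flipStep] at h
      · simp [hinj (List.map_injective_iff.2 flipStep_injective h)]
    · rintro ⟨p, hp⟩
      match p, hp with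
      | [], hp => exact absurd hp.1 (by simp; omega)
      | U :: p, hp =>
        obtain ⟨q, hq, h⟩ := hp.exists_nest
        exact ⟨Sum.inl ⟨q, by omega⟩, Subtype.ext h⟩
      | D :: p, hp =>
        obtain ⟨q, hq, h⟩ := IsFirstReturn.exists_nest (p := p.map flipStep) hp.map_flipStep
        refine ⟨Sum.inr ⟨q, by omega⟩, Subtype.ext ?_⟩
        have hc : flipStep ∘ flipStep = id := funext flipStep_flipStep
        simp [f, h, hc, flipStep]
  rw [← Nat.card_congr (Equiv.ofBijective f hf), Nat.card_sum, Nat.card_eq_fintype_card,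
    DyckWord.card_dyckWord_semilength_eq_catalan]
  ring

/-- The number of binary total words of length `n` with minimal abelian border
length `k`, `1 ≤ k ≤ ⌊n/2⌋`, is `2 ^ (n - 2k + 1) * C_{k-1}`. -/
theorem stmt_3 (n k : ℕ) (hk1 : 1 ≤ k) (hk2 : k ≤ n / 2) :
    Nat.card {w : List (Fin 2) // w.length = n ∧
        IsLeast {j | HasAbelianBorderT w j} k} =
      2 ^ (n - 2 * k + 1) * catalan (k - 1) := by
  have hlen {p : List DyckStep} {m : List (Fin 2)} (hp : p.length = 2 * k)
      (hm : m.length = n - 2 * k) : (wrapSteps p m).length = n := by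
    rw [length_wrapSteps hp, hm]
    omega
  let f : {p : List DyckStep // IsFirstReturn k p} × List.Vector (Fin 2) (n - 2 * k) →
      {w : List (Fin 2) // w.length = n ∧ IsLeast {j | HasAbelianBorderT w j} k} := fun x =>
    ⟨wrapSteps x.1.1 x.2.1, hlen x.1.2.1 x.2.2,
      (isLeast_border_wrapSteps_iff hk1 x.1.2.1 (hlen x.1.2.1 x.2.2)).2 x.1.2⟩
  have hf : Function.Bijective f := by
    constructor
    · rintro ⟨⟨p, hp⟩, ⟨m, hm⟩⟩ ⟨⟨q, hq⟩, ⟨m', hm'⟩⟩ h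
      obtain ⟨rfl, rfl⟩ := wrapSteps_inj hp.1 hq.1 (congrArg Subtype.val h)
      rfl
    · rintro ⟨w, hw, hk⟩
      obtain ⟨p, m, hp, rfl⟩ := exists_wrapSteps_eq k w (by omega)
      have hm := length_wrapSteps hp m
      exact ⟨⟨⟨p, (isLeast_border_wrapSteps_iff hk1 hp hw).1 hk⟩, ⟨m, by omega⟩⟩, rfl⟩
  rw [← Nat.card_congr (Equiv.ofBijective f hf), Nat.card_prod, card_isFirstReturn hk1,
    Nat.card_eq_fintype_card, card_vector, Fintype.card_fin]
  ring
end

section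
/- For n ≥ 1, the number of binary total words of length n that have no abelian borders equals binom(n, n/2) when n is even, and equals 2·binom(n−1, (n−1)/2) when n is odd. -/
/-- `StaysNonzero d w` says that `d` plus the difference between the numbers of ones in the
prefix and in the suffix of length `k` of `w` is nonzero for all `k` up to half the length of `w`. -/
def StaysNonzero (d : ℤ) (w : List (Fin 2)) : Prop :=
  ∀ k, 2 * k ≤ w.length →
    d + (w.take k).count 1 - (w.drop (w.length - k)).count 1 ≠ 0

/-- The number of walks of `m` steps, each the sum of two independent steps `±1/2`, that start
at `d` and stay positive. -/
def positiveWalks (m d : ℕ) : ℕ :=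
  ∑ i ∈ Finset.range d, (2 * m + 1).choose (m + 1 + i)

theorem positiveWalks_zero_left {d : ℕ} (hd : d ≠ 0) : positiveWalks 0 d = 1 := by
  obtain ⟨d, rfl⟩ := Nat.exists_eq_succ_of_ne_zero hd
  rw [positiveWalks, Finset.sum_range_succ', Finset.sum_eq_zero]
  · simp
  · intro i _
    exact Nat.choose_eq_zero_of_lt (by omega)

theorem choose_add_two (n k : ℕ) :
    (n + 2).choose (k + 2) = n.choose k + 2 * n.choose (k + 1) + n.choose (k + 2) := by
  simp only [Nat.choose_succ_succ']
  ring

theorem positiveWalks_succ_succ (m d : ℕ) :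
    positiveWalks (m + 1) (d + 1) =
      positiveWalks m d + 2 * positiveWalks m (d + 1) + positiveWalks m (d + 2) := by
  induction d with
  | zero =>
    have h := choose_add_two (2 * m + 1) m
    have h' := Nat.choose_symm_half m
    simp only [positiveWalks, Finset.sum_range_succ, Finset.sum_range_zero]
    rw [show 2 * (m + 1) + 1 = 2 * m + 1 + 2 by ring, show m + 1 + 1 + 0 = m + 2 by ring,
      show m + 1 + (0 + 1) = m + 2 by ring, Nat.add_zero (m + 1)]
    omega
  | succ d ih =>
    have h := choose_add_two (2 * m + 1) (m + 1 + d)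
    simp only [positiveWalks, Finset.sum_range_succ _ (d + 1), Finset.sum_range_succ _ (d + 2)]
      at ih ⊢
    rw [ih, show 2 * (m + 1) + 1 = 2 * m + 1 + 2 by ring,
      show m + 1 + 1 + (d + 1) = m + 1 + d + 2 by ring, h, Finset.sum_range_succ _ d]
    simp only [← Nat.add_assoc]
    ring

theorem not_staysNonzero_zero (w : List (Fin 2)) : ¬ StaysNonzero 0 w :=
  fun h => h 0 (by simp) (by simp)

theorem staysNonzero_of_length_le_one {d : ℤ} (hd : d ≠ 0) {w : List (Fin 2)}
    (hw : w.length ≤ 1) : StaysNonzero d w := by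
  intro k hk
  obtain rfl : k = 0 := by omega
  simpa using hd

theorem count_take_sub_count_drop_cons_concat (a b : Fin 2) (v : List (Fin 2)) {k : ℕ}
    (hk : k ≤ v.length) :
    (((a :: (v ++ [b])).take (k + 1)).count 1 : ℤ) -
        ((a :: (v ++ [b])).drop ((a :: (v ++ [b])).length - (k + 1))).count 1 =
      ((a : ℕ) : ℤ) - ((b : ℕ) : ℤ) + (v.take k).count 1 - (v.drop (v.length - k)).count 1 := by
  have hcount (c : Fin 2) (l : List (Fin 2)) : (c :: l).count 1 = l.count 1 + (c : ℕ) := by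
    fin_cases c <;> simp
  have hlen : (a :: (v ++ [b])).length - (k + 1) = v.length - k + 1 := by
    simp only [List.length_cons, List.length_append, List.length_nil]
    omega
  rw [hlen, List.take_succ_cons, List.drop_succ_cons, List.take_append_of_le_length hk,
    List.drop_append_of_le_length (by omega), hcount, List.count_append, hcount]
  simp only [List.count_nil]
  push_cast
  ring

theorem staysNonzero_cons_concat {d : ℤ} (hd : d ≠ 0) (a b : Fin 2) (v : List (Fin 2)) :
    StaysNonzero d (a :: (v ++ [b])) ↔ StaysNonzero (d + (a : ℕ) - (b : ℕ)) v := by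
  have hlen : (a :: (v ++ [b])).length = v.length + 2 := by simp
  constructor
  · intro h k hk
    have h1 := h (k + 1) (by omega)
    have h2 := count_take_sub_count_drop_cons_concat a b v (k := k) (by omega)
    intro h0
    apply h1
    linarith
  · rintro h (_ | k) hk
    · simpa using hd
    · have h1 := h k (by omega)
      have h2 := count_take_sub_count_drop_cons_concat a b v (k := k) (by omega)
      intro h0
      apply h1
      linarith

theorem perm_iff_count_one_eq {l₁ l₂ : List (Fin 2)} (h : l₁.length = l₂.length) :
    l₁.Perm l₂ ↔ l₁.count 1 = l₂.count 1 := by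
  have hlen (l : List (Fin 2)) : l.length = l.count 0 + l.count 1 := by
    induction l with
    | nil => rfl
    | cons c l ih => fin_cases c <;> simp [ih] <;> omega
  rw [List.perm_iff_count, Fin.forall_fin_two]
  have h1 := hlen l₁
  have h2 := hlen l₂
  omega

theorem hasAbelianBorderT_iff_count {w : List (Fin 2)} {k : ℕ} :
    HasAbelianBorderT w k ↔ 1 ≤ k ∧ k ≤ w.length - 1 ∧
      (w.take k).count 1 = (w.drop (w.length - k)).count 1 := by
  refine and_congr_right fun h1 => and_congr_right fun h2 => perm_iff_count_one_eq ?_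
  simp only [List.length_take, List.length_drop]
  omega

theorem HasAbelianBorderT.length_sub {w : List (Fin 2)} {k : ℕ} (h : HasAbelianBorderT w k) :
    HasAbelianBorderT w (w.length - k) := by
  rw [hasAbelianBorderT_iff_count] at h ⊢
  obtain ⟨h1, h2, h3⟩ := h
  refine ⟨by omega, by omega, ?_⟩
  have e1 : (w.take k).count 1 + (w.drop k).count 1 = w.count 1 := by
    rw [← List.count_append, List.take_append_drop]
  have e2 : (w.take (w.length - k)).count 1 + (w.drop (w.length - k)).count 1 = w.count 1 := by
    rw [← List.count_append, List.take_append_drop]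
  rw [show w.length - (w.length - k) = k by omega]
  omega

theorem forall_not_hasAbelianBorderT_cons_concat (a b : Fin 2) (v : List (Fin 2)) :
    (∀ k, ¬ HasAbelianBorderT (a :: (v ++ [b])) k) ↔
      StaysNonzero ((a : ℕ) - (b : ℕ)) v := by
  have hlen : (a :: (v ++ [b])).length = v.length + 2 := by simp
  have key {k : ℕ} (hk : k ≤ v.length) : HasAbelianBorderT (a :: (v ++ [b])) (k + 1) ↔
      ((a : ℕ) : ℤ) - ((b : ℕ) : ℤ) + (v.take k).count 1 - (v.drop (v.length - k)).count 1 = 0 := by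
    rw [hasAbelianBorderT_iff_count, ← count_take_sub_count_drop_cons_concat a b v hk,
      sub_eq_zero, Nat.cast_inj]
    exact ⟨fun h => h.2.2, fun h => ⟨by omega, by omega, h⟩⟩
  constructor
  · intro h k hk h0
    exact h (k + 1) ((key (by omega)).2 h0)
  · intro h
    have short (k : ℕ) (hk : 2 * k ≤ v.length + 2) : ¬ HasAbelianBorderT (a :: (v ++ [b])) k := by
      rintro hb
      obtain ⟨k, rfl⟩ := Nat.exists_eq_add_of_le' hb.1
      exact h k (by omega) ((key (by omega)).1 hb)
    intro k hb
    rcases le_total (2 * k) (v.length + 2) with hk | hk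
    · exact short k hk hb
    · exact short _ (by omega) hb.length_sub

instance finite_words (n : ℕ) (Q : List (Fin 2) → Prop) :
    Finite {w : List (Fin 2) // w.length = n ∧ Q w} :=
  ((List.finite_length_eq (Fin 2) n).subset fun _ h => h.1 :
    {w : List (Fin 2) | w.length = n ∧ Q w}.Finite).to_subtype

theorem card_words (n : ℕ) (Q : List (Fin 2) → Prop) (hQ : ∀ w, w.length = n → Q w) :
    Nat.card {w : List (Fin 2) // w.length = n ∧ Q w} = 2 ^ n := by
  have e : {w : List (Fin 2) // w.length = n ∧ Q w} ≃ List.Vector (Fin 2) n :=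
    Equiv.subtypeEquivRight fun w => ⟨fun h => h.1, fun h => ⟨h, hQ w h⟩⟩
  rw [Nat.card_congr e, Nat.card_eq_fintype_card, card_vector, Fintype.card_fin]

theorem card_words_add_two (n : ℕ) (Q : List (Fin 2) → Prop) :
    Nat.card {w : List (Fin 2) // w.length = n + 2 ∧ Q w} =
      ∑ p : Fin 2 × Fin 2,
        Nat.card {v : List (Fin 2) // v.length = n ∧ Q (p.1 :: (v ++ [p.2]))} := by
  rw [← Nat.card_sigma]
  symm
  refine Nat.card_congr (Equiv.ofBijective
    (fun x => ⟨x.1.1 :: (x.2.1 ++ [x.1.2]), by simp [x.2.2.1], x.2.2.2⟩) ⟨?_, ?_⟩)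
  · rintro ⟨⟨a, b⟩, v, hv⟩ ⟨⟨a', b'⟩, v', hv'⟩ h
    simp only [Subtype.mk.injEq, List.cons.injEq] at h
    obtain ⟨rfl, h⟩ := h
    obtain ⟨rfl, h⟩ := List.append_inj' h rfl
    obtain rfl : b = b' := by simpa using h
    rfl
  · rintro ⟨_ | ⟨a, u⟩, hw, hQ⟩
    · simp at hw
    · rcases List.eq_nil_or_concat u with rfl | ⟨v, b, rfl⟩
      · simp at hw
      · rw [List.concat_eq_append] at hw hQ
        exact ⟨⟨(a, b), v, by simpa using hw, hQ⟩, by simp⟩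

theorem card_staysNonzero (m e : ℕ) (he : e ≤ 1) (d : ℤ) :
    Nat.card {w : List (Fin 2) // w.length = 2 * m + e ∧ StaysNonzero d w} =
      2 ^ e * positiveWalks m d.natAbs := by
  induction m generalizing d with
  | zero =>
    rcases eq_or_ne d 0 with rfl | hd
    · simp [not_staysNonzero_zero, positiveWalks]
    · rw [positiveWalks_zero_left (by omega), card_words, Nat.mul_one]
      · simp
      · exact fun w hw => staysNonzero_of_length_le_one hd (by omega)
  | succ m ih =>
    rcases eq_or_ne d 0 with rfl | hd
    · simp [not_staysNonzero_zero, positiveWalks]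
    · rw [show 2 * (m + 1) + e = 2 * m + e + 2 by ring, card_words_add_two]
      simp only [staysNonzero_cons_concat hd, ih, Fintype.sum_prod_type, Fin.sum_univ_two,
        Fin.val_zero, Fin.val_one, Nat.cast_zero, Nat.cast_one, add_zero, sub_zero,
        add_sub_cancel_right]
      obtain ⟨j, rfl | rfl⟩ : ∃ j : ℕ, d = j + 1 ∨ d = -(j + 1) :=
        ⟨d.natAbs - 1, by omega⟩
      · rw [show ((j : ℤ) + 1).natAbs = j + 1 by omega,
          show ((j : ℤ) + 1 - 1).natAbs = j by omega,
          show ((j : ℤ) + 1 + 1).natAbs = j + 2 by omega, positiveWalks_succ_succ]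
        ring
      · rw [show (-((j : ℤ) + 1)).natAbs = j + 1 by omega,
          show (-((j : ℤ) + 1) - 1).natAbs = j + 2 by omega,
          show (-((j : ℤ) + 1) + 1).natAbs = j by omega, positiveWalks_succ_succ]
        ring

theorem card_forall_not_hasAbelianBorderT (m e : ℕ) (he : e ≤ 1) :
    Nat.card {w : List (Fin 2) // w.length = 2 * m + e + 2 ∧ ∀ k, ¬ HasAbelianBorderT w k} =
      2 ^ e * (2 * (m + 1)).choose (m + 1) := by
  rw [card_words_add_two]
  simp only [forall_not_hasAbelianBorderT_cons_concat, card_staysNonzero m e he,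
    Fintype.sum_prod_type, Fin.sum_univ_two, Fin.val_zero, Fin.val_one]
  have h := Nat.choose_symm_half m
  rw [show 2 * (m + 1) = 2 * m + 1 + 1 by ring, Nat.choose_succ_succ', ← h]
  simp [positiveWalks]
  ring

/-- The number of binary total words of length `n ≥ 1` with no abelian borders is
`binom(n, n/2)` for even `n` and `2 * binom(n-1, (n-1)/2)` for odd `n`. -/
theorem stmt_4 (n : ℕ) (hn : 1 ≤ n) :
    Nat.card {w : List (Fin 2) // w.length = n ∧ ∀ k, ¬ HasAbelianBorderT w k} =
      if Even n then n.choose (n / 2) else 2 * (n - 1).choose ((n - 1) / 2) := by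
  obtain rfl | hn2 : n = 1 ∨ 2 ≤ n := by omega
  · rw [card_words 1 _ fun w hw k hb => by have := hb.1; have := hb.2.1; omega]
    simp
  obtain ⟨m, rfl | rfl⟩ : ∃ m, n = 2 * m + 0 + 2 ∨ n = 2 * m + 1 + 2 :=
    ⟨(n - 2) / 2, by omega⟩
  · rw [card_forall_not_hasAbelianBorderT m 0 (by omega), if_pos ⟨m + 1, by ring⟩,
      show (2 * m + 0 + 2) / 2 = m + 1 by omega, pow_zero, one_mul]
    rfl
  · rw [card_forall_not_hasAbelianBorderT m 1 le_rfl, if_neg (by grind),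
      show (2 * m + 1 + 2 - 1) / 2 = m + 1 by omega]
    rfl
end

section
/- Fix an alphabet Σ of size σ ≥ 1, and let k ≥ 1, n ≥ 2k, and 0 ≤ h ≤ n. The number of partial words of length n with exactly h holes over Σ whose minimal abelian border length equals k is ∑_{j=0}^{h} g_σ(k,j) · binom(n−2k, h−j) · σ^{n−2k−h+j}, where g_σ(k,j) denotes the number of partial words of length 2k over Σ with exactly j holes whose minimal abelian border length equals k (terms with h−j > n−2k are zero). -/
namespace PWord

variable {α : Type*}

instance finite_words [Finite α] (n : ℕ) (p : PWord α → Prop) :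
    Finite {w : PWord α // w.length = n ∧ p w} :=
  ((List.finite_length_eq (Option α) n).subset fun _ hw => hw.1 :
    {w : PWord α | w.length = n ∧ p w}.Finite).to_subtype

/-- Splitting off the first letter of a partial word with at least one hole. -/
theorem bijective_cons (N r : ℕ) :
    Function.Bijective
      (Sum.elim (fun m => ⟨none :: m.1, by simp [m.2.1], by simp [m.2.2]⟩)
        (fun p => ⟨some p.1 :: p.2.1, by simp [p.2.2.1], by simp [p.2.2.2]⟩) :
        {m : PWord α // m.length = N ∧ m.countP (·.isNone) = r} ⊕
          α × {m : PWord α // m.length = N ∧ m.countP (·.isNone) = r + 1} →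
        {m : PWord α // m.length = N + 1 ∧ m.countP (·.isNone) = r + 1}) := by
  constructor
  · rintro (⟨m, hm⟩ | ⟨a, m, hm⟩) (⟨m', hm'⟩ | ⟨a', m', hm'⟩) h <;> simp_all
  · rintro ⟨_ | ⟨_ | a, m⟩, hl, hc⟩
    · simp at hl
    · exact ⟨.inl ⟨m, by simpa using hl, by simpa using hc⟩, rfl⟩
    · exact ⟨.inr ⟨a, m, by simpa using hl, by simpa using hc⟩, rfl⟩

/-- Splitting off the first letter of a partial word without holes. -/
theorem bijective_cons_total (N : ℕ) :
    Function.Bijective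
      (fun p => ⟨some p.1 :: p.2.1, by simp [p.2.2.1], by simpa using p.2.2.2⟩ :
        α × {m : PWord α // m.length = N ∧ m.countP (·.isNone) = 0} →
        {m : PWord α // m.length = N + 1 ∧ m.countP (·.isNone) = 0}) := by
  constructor
  · rintro ⟨a, m, hm⟩ ⟨a', m', hm'⟩ h
    simp_all
  · rintro ⟨_ | ⟨_ | a, m⟩, hl, hc⟩
    · simp at hl
    · simp at hc
    · exact ⟨⟨a, m, by simpa using hl, by simpa using hc⟩, rfl⟩

theorem card_length_holes [Finite α] (N r : ℕ) :
    Nat.card {m : PWord α // m.length = N ∧ m.countP (·.isNone) = r} =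
      N.choose r * Nat.card α ^ (N - r) := by
  induction N generalizing r with
  | zero =>
    cases r with
    | zero =>
      rw [Nat.card_eq_one_iff_unique.mpr]
      · simp
      · exact ⟨⟨fun a b => Subtype.ext <|
          (List.length_eq_zero_iff.mp a.2.1).trans (List.length_eq_zero_iff.mp b.2.1).symm⟩,
          ⟨⟨[], by simp⟩⟩⟩
    | succ r =>
      have : IsEmpty {m : PWord α // m.length = 0 ∧ m.countP (·.isNone) = r + 1} :=
        ⟨fun ⟨m, hl, hc⟩ => by
          rw [List.length_eq_zero_iff] at hl
          simp [hl] at hc⟩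
      rw [Nat.card_of_isEmpty, Nat.choose_zero_succ, zero_mul]
  | succ N ih =>
    cases r with
    | zero =>
      rw [← Nat.card_eq_of_bijective _ (bijective_cons_total N), Nat.card_prod, ih]
      simp [pow_succ']
    | succ r =>
      rw [← Nat.card_eq_of_bijective _ (bijective_cons N r), Nat.card_sum, Nat.card_prod, ih, ih,
        Nat.choose_succ_succ, Nat.add_sub_add_right]
      rcases lt_or_ge r N with h | h
      · obtain ⟨d, rfl⟩ := Nat.exists_eq_add_of_lt h
        rw [show r + d + 1 - r = d + 1 by lia, show r + d + 1 - (r + 1) = d by lia]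
        ring
      · simp [Nat.choose_eq_zero_of_lt (Nat.lt_succ_of_le h)]

/-- Abelian borders of length at most `k` only depend on the outer blocks of length `k`. -/
theorem hasAbelianBorder_append_middle {a m b : PWord α} {k i : ℕ} (ha : a.length = k)
    (hb : b.length = k) (hi : i ≤ k) :
    HasAbelianBorder (a ++ m ++ b) i ↔ HasAbelianBorder (a ++ b) i := by
  have hpre (c : PWord α) : (a ++ c).take i = a.take i :=
    List.take_append_of_le_length (ha ▸ hi)
  have hsuf (c : PWord α) : (c ++ b).drop ((c ++ b).length - i) = b.drop (k - i) := by
    rw [List.length_append, hb, Nat.add_sub_assoc hi, List.drop_length_add_append]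
  unfold HasAbelianBorder
  rw [hsuf, hsuf, List.append_assoc, hpre, hpre]
  refine and_congr_right fun h1 => and_congr_left fun _ => ?_
  simp only [List.length_append]
  lia

theorem isLeast_hasAbelianBorder_append_middle {a m b : PWord α} {k : ℕ} (ha : a.length = k)
    (hb : b.length = k) :
    IsLeast {i | HasAbelianBorder (a ++ m ++ b) i} k ↔
      IsLeast {i | HasAbelianBorder (a ++ b) i} k := by
  refine and_congr (hasAbelianBorder_append_middle ha hb le_rfl) ?_
  refine forall_congr' fun i => ?_
  rcases le_total i k with hi | hi
  · exact imp_congr_left (hasAbelianBorder_append_middle ha hb hi)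
  · exact iff_of_true (fun _ => hi) fun _ => hi

/-- Inserting a middle block into a partial word of length `2 * k` with minimal abelian border
length `k`. -/
def insertMiddle {k n h : ℕ} (hn : 2 * k ≤ n) :
    (Σ j : Fin (h + 1),
      {u : PWord α // u.length = 2 * k ∧ u.countP (·.isNone) = j ∧
        IsLeast {i | HasAbelianBorder u i} k} ×
      {m : PWord α // m.length = n - 2 * k ∧ m.countP (·.isNone) = h - j}) →
    {w : PWord α // w.length = n ∧ w.countP (·.isNone) = h ∧
      IsLeast {i | HasAbelianBorder w i} k} :=
  fun ⟨j, ⟨u, hu⟩, ⟨m, hm⟩⟩ => ⟨u.take k ++ m ++ u.drop k, by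
    simp only [List.length_append, List.length_take, List.length_drop]
    lia, by
    have hc : (u.take k ++ u.drop k).countP (·.isNone) = j := by
      rw [List.take_append_drop, hu.2.1]
    have := j.2
    simp only [List.countP_append] at hc ⊢
    lia, by
    rw [isLeast_hasAbelianBorder_append_middle (by simp; lia) (by simp; lia),
      List.take_append_drop]
    exact hu.2.2⟩

theorem bijective_insertMiddle {k n h : ℕ} (hn : 2 * k ≤ n) :
    Function.Bijective (insertMiddle (α := α) (h := h) hn) := by
  constructor
  · rintro ⟨⟨j, hj⟩, ⟨u, hu⟩, ⟨m, hm⟩⟩ ⟨⟨j', hj'⟩, ⟨u', hu'⟩, ⟨m', hm'⟩⟩ heq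
    have heq : u.take k ++ m ++ u.drop k = u'.take k ++ m' ++ u'.drop k :=
      congrArg Subtype.val heq
    obtain ⟨h₁, hd⟩ := List.append_inj' heq (by simp [hu.1, hu'.1])
    obtain ⟨ht, rfl⟩ := List.append_inj h₁ (by simp [hu.1, hu'.1])
    obtain rfl : u = u' := by
      rw [← List.take_append_drop k u, ht, hd, List.take_append_drop]
    obtain rfl : j = j' := hu.2.1.symm.trans hu'.2.1
    rfl
  · rintro ⟨w, hl, hc, hw⟩
    obtain ⟨a, m, b, ha, hb, rfl⟩ :
        ∃ a m b : PWord α, a.length = k ∧ b.length = k ∧ w = a ++ m ++ b :=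
      ⟨w.take k, (w.drop k).take (n - 2 * k), (w.drop k).drop (n - 2 * k), by simp; lia,
        by simp; lia, by rw [List.append_assoc, List.take_append_drop, List.take_append_drop]⟩
    simp only [List.length_append, List.countP_append] at hl hc
    refine ⟨⟨⟨(a ++ b).countP (·.isNone), by simp only [List.countP_append]; lia⟩,
      ⟨a ++ b, by simp only [List.length_append]; lia, rfl,
        (isLeast_hasAbelianBorder_append_middle ha hb).mp hw⟩,
      ⟨m, by lia, by simp only [List.countP_append]; lia⟩⟩, Subtype.ext ?_⟩
    simp [insertMiddle, ← ha]

end PWord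

/-- Over an alphabet of size `σ ≥ 1`, the number of partial words of length
`n ≥ 2k` with exactly `h` holes and minimal abelian border length `k` is
`∑_{j=0}^{h} g_σ(k,j) * binom(n-2k, h-j) * σ^(n-2k-(h-j))`, where `g_σ(k,j)` is
the number of partial words of length `2k` with exactly `j` holes and minimal
abelian border length `k`. -/
theorem stmt_7 {α : Type*} [Fintype α] (σ k n h : ℕ)
    (hcard : Fintype.card α = σ) (hσ : 1 ≤ σ) (hk : 1 ≤ k) (hn : 2 * k ≤ n)
    (hh : h ≤ n) :
    Nat.card {w : PWord α // w.length = n ∧ w.countP (·.isNone) = h ∧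
        IsLeast {j | HasAbelianBorder w j} k} =
      ∑ j ∈ Finset.range (h + 1),
        Nat.card {u : PWord α // u.length = 2 * k ∧ u.countP (·.isNone) = j ∧
            IsLeast {i | HasAbelianBorder u i} k} *
          (n - 2 * k).choose (h - j) * σ ^ (n - 2 * k - (h - j)) := by
  subst hcard
  rw [← Nat.card_eq_of_bijective _ (PWord.bijective_insertMiddle hn), Nat.card_sigma,
    Finset.sum_range]
  refine Finset.sum_congr rfl fun j _ => ?_
  rw [Nat.card_prod, PWord.card_length_holes, Nat.card_eq_fintype_card (α := α), mul_assoc]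
end

section
/- For k ≥ 2 and 0 ≤ j ≤ k, the number of binary partial words of length 2k with exactly j holes whose minimal abelian border length equals k is 2·binom(k,j)·C_{k−1}. Consequently, for k ≥ 2, n ≥ 2k and 0 ≤ h ≤ n, the number of binary partial words of length n with exactly h holes whose minimal abelian border length equals k is ∑_{j=0}^{h} 2·binom(k,j)·C_{k−1}·binom(n−2k, h−j)·2^{n−2k−h+j} (terms with h−j > n−2k being zero), where C_j denotes the j-th Catalan number. -/
open Polynomial Finset

/-! ### Summing over words of fixed length -/

section Words

variable {α : Type*} [Fintype α]

/-- The finite set of words of length `n` over a finite alphabet. -/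
noncomputable def wordsOfLength (α : Type*) [Fintype α] (n : ℕ) : Finset (List α) :=
  (List.finite_length_eq α n).toFinset

@[simp]
theorem mem_wordsOfLength {n : ℕ} {w : List α} : w ∈ wordsOfLength α n ↔ w.length = n := by
  simp [wordsOfLength]

variable {M : Type*} [AddCommMonoid M]

theorem sum_wordsOfLength_zero (f : List α → M) : ∑ w ∈ wordsOfLength α 0, f w = f [] := by
  have : wordsOfLength α 0 = {[]} := by ext w; simp
  rw [this, sum_singleton]

theorem sum_wordsOfLength_succ (n : ℕ) (f : List α → M) :
    ∑ w ∈ wordsOfLength α (n + 1), f w = ∑ a, ∑ w ∈ wordsOfLength α n, f (a :: w) := by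
  rw [← sum_product']
  symm
  refine sum_bij (fun p _ => p.1 :: p.2) ?_ ?_ ?_ ?_
  · simp
  · rintro ⟨a, w⟩ _ ⟨b, v⟩ _ h
    simpa using h
  · rintro (_ | ⟨a, w⟩) hw
    · simp at hw
    · exact ⟨(a, w), by simpa using hw, rfl⟩
  · simp

theorem sum_wordsOfLength_reverse (n : ℕ) (f : List α → M) :
    ∑ w ∈ wordsOfLength α n, f w.reverse = ∑ w ∈ wordsOfLength α n, f w :=
  sum_nbij' List.reverse List.reverse (by simp) (by simp) (by simp) (by simp) (by simp)

theorem sum_wordsOfLength_add_two (n : ℕ) (f : List α → M) :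
    ∑ w ∈ wordsOfLength α (n + 2), f w =
      ∑ a, ∑ b, ∑ w ∈ wordsOfLength α n, f (a :: (w ++ [b])) := by
  rw [sum_wordsOfLength_succ]
  refine sum_congr rfl fun a _ => ?_
  rw [← sum_wordsOfLength_reverse, sum_wordsOfLength_succ]
  refine sum_congr rfl fun b _ => ?_
  rw [← sum_wordsOfLength_reverse]
  simp

end Words

/-! ### Abelian compatibility of binary partial words -/

/-- The number of positions of `w` that are filled by `1` in every completion. -/
def minOnes (w : PWord (Fin 2)) : ℕ := w.countP (· == some 1)

/-- The number of positions of `w` that are filled by `1` in some completion. -/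
def maxOnes (w : PWord (Fin 2)) : ℕ := w.countP (· != some 0)

theorem minOnes_cons (a : Option (Fin 2)) (w : PWord (Fin 2)) :
    minOnes (a :: w) = minOnes w + if a = some 1 then 1 else 0 := by
  simp [minOnes, List.countP_cons]

theorem maxOnes_cons (a : Option (Fin 2)) (w : PWord (Fin 2)) :
    maxOnes (a :: w) = maxOnes w + if a = some 0 then 0 else 1 := by
  by_cases h : a = some 0 <;> simp [maxOnes, h]

@[simp] theorem minOnes_nil : minOnes [] = 0 := rfl

@[simp] theorem maxOnes_nil : maxOnes [] = 0 := rfl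

@[simp] theorem minOnes_reverse (w : PWord (Fin 2)) : minOnes w.reverse = minOnes w := by
  simp [minOnes]

@[simp] theorem maxOnes_reverse (w : PWord (Fin 2)) : maxOnes w.reverse = maxOnes w := by
  simp [maxOnes]

theorem minOnes_le_maxOnes (w : PWord (Fin 2)) : minOnes w ≤ maxOnes w := by
  induction w with
  | nil => rfl
  | cons a w ih =>
    rw [minOnes_cons, maxOnes_cons]
    rcases a with _ | a
    · simp; omega
    · fin_cases a <;> simp <;> omega

theorem IsCompletion.count_one_mem {w : PWord (Fin 2)} {c : List (Fin 2)}
    (h : IsCompletion w c) : minOnes w ≤ c.count 1 ∧ c.count 1 ≤ maxOnes w := by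
  induction h with
  | nil => simp
  | @cons a b w c hab _ ih =>
    rw [minOnes_cons, maxOnes_cons, List.count_cons]
    rcases a with _ | a
    · fin_cases b <;> simp <;> omega
    · obtain rfl := hab a rfl
      fin_cases a <;> simp <;> omega

theorem exists_isCompletion_count_one (w : PWord (Fin 2)) {t : ℕ} (h₁ : minOnes w ≤ t)
    (h₂ : t ≤ maxOnes w) : ∃ c, IsCompletion w c ∧ c.count 1 = t := by
  induction w generalizing t with
  | nil => exact ⟨[], List.Forall₂.nil, by simp at h₂; simp [h₂]⟩
  | cons a w ih =>
    rw [minOnes_cons] at h₁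
    rw [maxOnes_cons] at h₂
    rcases a with _ | a
    · simp at h₁ h₂
      rcases Nat.lt_or_ge (maxOnes w) t with ht | ht
      · obtain ⟨c, hc, hct⟩ := ih (t := t - 1)
          (by have := minOnes_le_maxOnes w; omega) (by omega)
        exact ⟨1 :: c, List.Forall₂.cons (by simp) hc, by simp [hct]; omega⟩
      · obtain ⟨c, hc, hct⟩ := ih h₁ ht
        exact ⟨0 :: c, List.Forall₂.cons (by simp) hc, by simp [hct]⟩
    · fin_cases a
      · simp at h₁ h₂
        obtain ⟨c, hc, hct⟩ := ih h₁ h₂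
        exact ⟨0 :: c, List.Forall₂.cons (by simp) hc, by simp [hct]⟩
      · simp at h₁ h₂
        obtain ⟨c, hc, hct⟩ := ih (t := t - 1) (by omega) (by omega)
        exact ⟨1 :: c, List.Forall₂.cons (by simp) hc, by simp [hct]; omega⟩

theorem count_zero_add_count_one (c : List (Fin 2)) : c.count 0 + c.count 1 = c.length := by
  induction c with
  | nil => rfl
  | cons a c ih => fin_cases a <;> simp <;> omega

theorem perm_of_length_of_count_one {c d : List (Fin 2)} (hl : c.length = d.length)
    (h : c.count 1 = d.count 1) : c.Perm d := by
  rw [List.perm_iff_count]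
  have hc := count_zero_add_count_one c
  have hd := count_zero_add_count_one d
  intro a
  fin_cases a
  · change c.count 0 = d.count 0
    omega
  · exact h

theorem abelianCompat_iff {u v : PWord (Fin 2)} (hl : u.length = v.length) :
    AbelianCompat u v ↔ minOnes u ≤ maxOnes v ∧ minOnes v ≤ maxOnes u := by
  constructor
  · rintro ⟨c, d, hc, hd, hp⟩
    have h := hp.count_eq 1
    have h₁ := hc.count_one_mem
    have h₂ := hd.count_one_mem
    omega
  · rintro ⟨h₁, h₂⟩
    have hu := minOnes_le_maxOnes u
    have hv := minOnes_le_maxOnes v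
    obtain ⟨c, hc, hct⟩ := exists_isCompletion_count_one u
      (le_max_left (minOnes u) (minOnes v)) (max_le hu h₂)
    obtain ⟨d, hd, hdt⟩ := exists_isCompletion_count_one v
      (le_max_right (minOnes u) (minOnes v)) (max_le h₁ hv)
    refine ⟨c, d, hc, hd, perm_of_length_of_count_one ?_ (hct.trans hdt.symm)⟩
    rw [← List.Forall₂.length_eq hc, ← List.Forall₂.length_eq hd, hl]

/-! ### Borders in terms of a height function -/

/-- The least number of ones in a completion of the prefix of length `i`, minus the largest
number of ones in a completion of the suffix of length `i`. -/
def borderHeight (w : PWord (Fin 2)) (i : ℕ) : ℤ :=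
  minOnes (w.take i) - maxOnes (w.reverse.take i)

/-- The change of `borderHeight` caused by an outermost pair of letters. -/
def heightStep (a b : Option (Fin 2)) : ℤ :=
  (if a = some 1 then 1 else 0) - (if b = some 0 then 0 else 1)

@[simp] theorem borderHeight_zero (w : PWord (Fin 2)) : borderHeight w 0 = 0 := by
  simp [borderHeight]

theorem borderHeight_cons_append (a b : Option (Fin 2)) {w : PWord (Fin 2)} {i : ℕ}
    (hi : i ≤ w.length) :
    borderHeight (a :: (w ++ [b])) (i + 1) = heightStep a b + borderHeight w i := by
  have h : (a :: (w ++ [b])).reverse = b :: (w.reverse ++ [a]) := by simp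
  rw [borderHeight, h, List.take_succ_cons, List.take_succ_cons,
    List.take_append_of_le_length hi, List.take_append_of_le_length (by simpa using hi),
    minOnes_cons, maxOnes_cons, borderHeight, heightStep]
  push_cast
  ring

theorem borderHeight_add_reverse_nonpos (w : PWord (Fin 2)) (i : ℕ) :
    borderHeight w i + borderHeight w.reverse i ≤ 0 := by
  have h₁ := minOnes_le_maxOnes (w.take i)
  have h₂ := minOnes_le_maxOnes (w.reverse.take i)
  simp only [borderHeight, List.reverse_reverse]
  omega

theorem minOnes_take_succ (w : PWord (Fin 2)) (i : ℕ) :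
    minOnes (w.take i) ≤ minOnes (w.take (i + 1)) ∧
      minOnes (w.take (i + 1)) ≤ minOnes (w.take i) + 1 := by
  induction w generalizing i with
  | nil => simp
  | cons a w ih =>
    cases i with
    | zero => simp [minOnes_cons]; split_ifs <;> simp
    | succ i =>
      have := ih i
      simp only [List.take_succ_cons, minOnes_cons]
      omega

theorem maxOnes_take_succ (w : PWord (Fin 2)) (i : ℕ) :
    maxOnes (w.take i) ≤ maxOnes (w.take (i + 1)) ∧
      maxOnes (w.take (i + 1)) ≤ maxOnes (w.take i) + 1 := by
  induction w generalizing i with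
  | nil => simp
  | cons a w ih =>
    cases i with
    | zero => simp [maxOnes_cons]; split_ifs <;> simp
    | succ i =>
      have := ih i
      simp only [List.take_succ_cons, maxOnes_cons]
      omega

theorem borderHeight_succ (w : PWord (Fin 2)) (i : ℕ) :
    borderHeight w i ≤ borderHeight w (i + 1) + 1 ∧
      borderHeight w (i + 1) ≤ borderHeight w i + 1 := by
  have h₁ := minOnes_take_succ w i
  have h₂ := maxOnes_take_succ w.reverse i
  simp only [borderHeight]
  omega

theorem hasAbelianBorder_iff (w : PWord (Fin 2)) (i : ℕ) :
    HasAbelianBorder w i ↔ 1 ≤ i ∧ i ≤ w.length - 1 ∧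
      borderHeight w i ≤ 0 ∧ borderHeight w.reverse i ≤ 0 := by
  refine and_congr_right fun h₁ => and_congr_right fun h₂ => ?_
  rw [abelianCompat_iff (by simp; omega)]
  have h : w.drop (w.length - i) = (w.reverse.take i).reverse := by simp [List.take_reverse]
  simp only [h, borderHeight, List.reverse_reverse, minOnes_reverse, maxOnes_reverse]
  omega

/-- The heights of `w` are positive up to `k`, where they vanish. -/
def IsExcursion (k : ℕ) (w : PWord (Fin 2)) : Prop :=
  (∀ i, 1 ≤ i → i < k → 0 < borderHeight w i) ∧ borderHeight w k = 0

theorem isExcursion_of_pos {k : ℕ} (hk : 2 ≤ k) {w : PWord (Fin 2)}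
    (h : ∀ i, 1 ≤ i → i < k → 0 < borderHeight w i ∨ 0 < borderHeight w.reverse i)
    (hw : borderHeight w k ≤ 0) (h₁ : 0 < borderHeight w 1) : IsExcursion k w := by
  have pos : ∀ i, 1 ≤ i → i < k → 0 < borderHeight w i := by
    intro i hi
    induction i, hi using Nat.le_induction with
    | base => exact fun _ => h₁
    | succ i hi ih =>
      intro hik
      have h₂ := ih (by omega)
      have h₃ := borderHeight_add_reverse_nonpos w i
      have h₄ := borderHeight_succ w.reverse i
      rcases h (i + 1) (by omega) hik with h₅ | h₅ <;> omega
  refine ⟨pos, ?_⟩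
  obtain ⟨m, rfl⟩ : ∃ m, k = m + 1 := ⟨k - 1, by omega⟩
  have h₂ := pos m (by omega) (by omega)
  have h₃ := borderHeight_succ w m
  omega

theorem isLeast_hasAbelianBorder_iff {k : ℕ} (hk : 2 ≤ k) {w : PWord (Fin 2)}
    (hw : 2 * k ≤ w.length) :
    IsLeast {i | HasAbelianBorder w i} k ↔ IsExcursion k w ∨ IsExcursion k w.reverse := by
  constructor
  · rintro ⟨h₁, h₂⟩
    rw [Set.mem_ofPred_eq, hasAbelianBorder_iff] at h₁
    have h : ∀ i, 1 ≤ i → i < k → 0 < borderHeight w i ∨ 0 < borderHeight w.reverse i := by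
      intro i hi hik
      by_contra! hn
      have : k ≤ i := h₂ ((hasAbelianBorder_iff w i).2 ⟨hi, by omega, hn⟩)
      omega
    rcases h 1 le_rfl (by omega) with h' | h'
    · exact Or.inl (isExcursion_of_pos hk h h₁.2.2.1 h')
    · refine Or.inr (isExcursion_of_pos hk (fun i hi hik => ?_) h₁.2.2.2 h')
      rw [List.reverse_reverse]
      exact (h i hi hik).symm
  · intro h
    have hs := borderHeight_add_reverse_nonpos w
    obtain ⟨j, hj⟩ : ∃ j, k = j + 1 := ⟨k - 1, by omega⟩
    constructor
    · rw [Set.mem_ofPred_eq, hasAbelianBorder_iff]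
      refine ⟨by omega, by omega, ?_⟩
      have h₁ := hs j
      have h₂ := hs k
      have h₃ := borderHeight_succ w j
      have h₄ := borderHeight_succ w.reverse j
      rw [hj] at h h₂ ⊢
      rcases h with ⟨h, h'⟩ | ⟨h, h'⟩ <;> have := h j (by omega) (by omega) <;> omega
    · intro i hi
      rw [Set.mem_ofPred_eq, hasAbelianBorder_iff] at hi
      by_contra! hik
      rcases h with ⟨h, -⟩ | ⟨h, -⟩ <;> have := h i hi.1 hik <;> omega

theorem IsExcursion.not_reverse {k : ℕ} (hk : 2 ≤ k) {w : PWord (Fin 2)}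
    (h : IsExcursion k w) : ¬ IsExcursion k w.reverse := fun h' => by
  have h₁ := h.1 1 le_rfl (by omega)
  have h₂ := h'.1 1 le_rfl (by omega)
  have := borderHeight_add_reverse_nonpos w 1
  omega

/-! ### Counting excursions -/

/-- The monomial recording the number of holes of `w`. -/
noncomputable def holeWeight (w : PWord (Fin 2)) : ℤ[X] := X ^ w.countP (·.isNone)

/-- Started at height `d`, the heights of `w` are positive up to `m`, where they vanish. -/
def HitsZeroAt (m : ℕ) (d : ℤ) (w : PWord (Fin 2)) : Prop :=
  (∀ i < m, 0 < d + borderHeight w i) ∧ d + borderHeight w m = 0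

open Classical in
/-- The generating polynomial, by number of holes, of the words of length `2 * m + r` that
reach height `0` for the first time after `m` steps from height `d`. -/
noncomputable def hittingPoly (r m : ℕ) (d : ℤ) : ℤ[X] :=
  ∑ w ∈ wordsOfLength (Option (Fin 2)) (2 * m + r), if HitsZeroAt m d w then holeWeight w else 0

theorem holeWeight_cons (a : Option (Fin 2)) (w : PWord (Fin 2)) :
    holeWeight (a :: w) = holeWeight [a] * holeWeight w := by
  rw [holeWeight, holeWeight, holeWeight, ← pow_add, ← List.countP_append, List.singleton_append]

theorem holeWeight_cons_append (a b : Option (Fin 2)) (w : PWord (Fin 2)) :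
    holeWeight (a :: (w ++ [b])) = holeWeight [a] * holeWeight [b] * holeWeight w := by
  simp only [holeWeight, ← pow_add, ← List.countP_append]
  congr 1
  simp [List.countP_append, List.countP_cons]

theorem sum_holeWeight (r : ℕ) :
    ∑ w ∈ wordsOfLength (Option (Fin 2)) r, holeWeight w = (X + C 2) ^ r := by
  induction r with
  | zero => simp [sum_wordsOfLength_zero, holeWeight]
  | succ r ih =>
    rw [sum_wordsOfLength_succ]
    have h (a : Option (Fin 2)) : ∑ w ∈ wordsOfLength (Option (Fin 2)) r, holeWeight (a :: w) =
        holeWeight [a] * (X + C 2) ^ r := by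
      rw [← ih, mul_sum]
      exact sum_congr rfl fun w _ => holeWeight_cons a w
    simp only [h, ← sum_mul]
    rw [pow_succ']
    congr 1
    simp [Fintype.sum_option, holeWeight]

theorem hittingPoly_zero (r : ℕ) (d : ℤ) :
    hittingPoly r 0 d = if d = 0 then (X + C 2) ^ r else 0 := by
  split_ifs with h <;> simp [hittingPoly, HitsZeroAt, h, sum_holeWeight]

theorem hittingPoly_succ_zero (r m : ℕ) : hittingPoly r (m + 1) 0 = 0 := by
  refine sum_eq_zero fun w _ => if_neg fun h => ?_
  have := h.1 0 (by omega)
  simp at this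

theorem hitsZeroAt_cons_append {m : ℕ} {d : ℤ} (hd : 0 < d) (a b : Option (Fin 2))
    {w : PWord (Fin 2)} (hw : m ≤ w.length) :
    HitsZeroAt (m + 1) d (a :: (w ++ [b])) ↔ HitsZeroAt m (d + heightStep a b) w := by
  rw [HitsZeroAt, HitsZeroAt, borderHeight_cons_append a b hw, ← add_assoc]
  refine and_congr_left fun _ => ⟨fun h i hi => ?_, fun h i hi => ?_⟩
  · have := h (i + 1) (by omega)
    rwa [borderHeight_cons_append a b (by omega), ← add_assoc] at this
  · rcases i with _ | i
    · simpa using hd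
    · rw [borderHeight_cons_append a b (by omega), ← add_assoc]
      exact h i (by omega)

theorem hittingPoly_succ (r m : ℕ) {d : ℤ} (hd : 0 < d) :
    hittingPoly r (m + 1) d = hittingPoly r m (d + 1) + 2 * (1 + X) * hittingPoly r m d +
      (1 + X) ^ 2 * hittingPoly r m (d - 1) := by
  classical
  have key : hittingPoly r (m + 1) d = ∑ a, ∑ b,
      holeWeight [a] * holeWeight [b] * hittingPoly r m (d + heightStep a b) := by
    rw [hittingPoly, show 2 * (m + 1) + r = 2 * m + r + 2 by ring, sum_wordsOfLength_add_two]
    refine sum_congr rfl fun a _ => sum_congr rfl fun b _ => ?_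
    rw [hittingPoly, mul_sum]
    refine sum_congr rfl fun w hw => ?_
    rw [mem_wordsOfLength] at hw
    rw [mul_ite, mul_zero, holeWeight_cons_append]
    exact if_congr (hitsZeroAt_cons_append hd a b (by omega)) rfl rfl
  rw [key]
  simp [Fintype.sum_option, holeWeight, heightStep, ← sub_eq_add_neg]
  ring

/-- The ballot number counting paths with `2 * m + 2` unit steps from height `2 * d` that reach
height `0` only at the end. -/
def ballotNumber (m d : ℕ) : ℤ :=
  (2 * m + 1).choose (m + d) - (2 * m + 1).choose (m + d + 1)

theorem ballotNumber_zero_right (m : ℕ) : ballotNumber m 0 = 0 := by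
  have := Nat.choose_symm_half m
  simp [ballotNumber, this]

theorem ballotNumber_succ (m d : ℕ) :
    ballotNumber (m + 1) (d + 1) =
      ballotNumber m (d + 2) + 2 * ballotNumber m (d + 1) + ballotNumber m d := by
  have h (s : ℕ) : (2 * (m + 1) + 1).choose (s + 2) = (2 * m + 1).choose s +
      2 * (2 * m + 1).choose (s + 1) + (2 * m + 1).choose (s + 2) := by
    rw [show 2 * (m + 1) + 1 = 2 * m + 1 + 1 + 1 by ring, Nat.choose_succ_succ' (2 * m + 1 + 1),
      Nat.choose_succ_succ' (2 * m + 1), Nat.choose_succ_succ' (2 * m + 1)]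
    ring
  have h₁ := h (m + d)
  have h₂ := h (m + d + 1)
  simp only [ballotNumber, show m + 1 + (d + 1) = m + d + 2 by ring,
    show m + (d + 2) = m + d + 2 by ring, show m + (d + 1) = m + d + 1 by ring, h₁,
    show m + d + 2 + 1 = m + d + 1 + 2 by ring, h₂, show m + d + 1 + 1 = m + d + 2 by ring]
  push_cast
  ring

theorem ballotNumber_one (m : ℕ) : ballotNumber m 1 = catalan (m + 1) := by
  have h₁ := succ_mul_catalan_eq_centralBinom (m + 1)
  have h₂ := Nat.choose_succ_right_eq (2 * m + 1) (m + 1)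
  have h₃ : (m + 1).centralBinom = 2 * (2 * m + 1).choose (m + 1) := by
    rw [Nat.centralBinom, show 2 * (m + 1) = 2 * m + 1 + 1 by ring, Nat.choose_succ_succ',
      Nat.choose_symm_half]
    ring
  rw [h₃] at h₁
  rw [show 2 * m + 1 - (m + 1) = m by omega] at h₂
  rw [ballotNumber]
  zify at h₁ h₂
  have h₄ : (m + 2 : ℤ) ≠ 0 := by positivity
  apply mul_left_cancel₀ h₄
  linear_combination -h₁ - h₂

theorem hittingPoly_eq (r m d : ℕ) : hittingPoly r (m + 1) d =
    C (ballotNumber m d) * (1 + X) ^ (m + 1 + d) * (X + C 2) ^ r := by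
  induction m generalizing d with
  | zero =>
    rcases d with _ | d
    · simpa [ballotNumber_zero_right] using hittingPoly_succ_zero r 0
    · rw [hittingPoly_succ r 0 (by positivity)]
      simp only [hittingPoly_zero]
      rcases d with _ | d
      · simp [ballotNumber]
      · rw [if_neg (by positivity), if_neg (by positivity), if_neg (by push_cast; omega)]
        simp [ballotNumber, Nat.choose_eq_zero_of_lt]
  | succ m ih =>
    rcases d with _ | d
    · simpa [ballotNumber_zero_right] using hittingPoly_succ_zero r (m + 1)
    · rw [hittingPoly_succ r (m + 1) (by positivity), ballotNumber_succ]
      have h₁ := ih (d + 2)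
      have h₂ := ih (d + 1)
      have h₃ := ih d
      rw [show ((d + 1 : ℕ) : ℤ) + 1 = ((d + 2 : ℕ) : ℤ) by push_cast; ring,
        show ((d + 1 : ℕ) : ℤ) - 1 = (d : ℤ) by push_cast; ring, h₁, h₂, h₃]
      simp only [map_add, map_mul, map_ofNat]
      ring

theorem isExcursion_cons_append {m : ℕ} (hm : 1 ≤ m) (a b : Option (Fin 2))
    {w : PWord (Fin 2)} (hw : m ≤ w.length) :
    IsExcursion (m + 1) (a :: (w ++ [b])) ↔ (a = some 1 ∧ b = some 0) ∧ HitsZeroAt m 1 w := by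
  have hs : 0 < heightStep a b ↔ a = some 1 ∧ b = some 0 := by
    by_cases ha : a = some 1 <;> by_cases hb : b = some 0 <;> simp [heightStep, ha, hb]
  rw [IsExcursion, HitsZeroAt, borderHeight_cons_append a b hw]
  constructor
  · rintro ⟨h₁, h₂⟩
    have h := h₁ 1 le_rfl (by omega)
    rw [borderHeight_cons_append a b (Nat.zero_le _), borderHeight_zero, add_zero, hs] at h
    obtain ⟨rfl, rfl⟩ := h
    refine ⟨⟨rfl, rfl⟩, fun i hi => ?_, h₂⟩
    have := h₁ (i + 1) (by omega) (by omega)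
    rwa [borderHeight_cons_append _ _ (by omega)] at this
  · rintro ⟨⟨rfl, rfl⟩, h₁, h₂⟩
    refine ⟨fun i hi him => ?_, h₂⟩
    obtain ⟨i, rfl⟩ : ∃ j, i = j + 1 := ⟨i - 1, by omega⟩
    rw [borderHeight_cons_append _ _ (by omega)]
    exact h₁ i (by omega)

open Classical in
theorem sum_isExcursion (r m : ℕ) (hm : 1 ≤ m) :
    ∑ w ∈ wordsOfLength (Option (Fin 2)) (2 * (m + 1) + r),
      (if IsExcursion (m + 1) w then holeWeight w else 0) = hittingPoly r m 1 := by
  have key : ∑ w ∈ wordsOfLength (Option (Fin 2)) (2 * (m + 1) + r),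
      (if IsExcursion (m + 1) w then holeWeight w else 0) = ∑ a, ∑ b,
      if a = some 1 ∧ b = some 0 then holeWeight [a] * holeWeight [b] * hittingPoly r m 1
      else 0 := by
    rw [show 2 * (m + 1) + r = 2 * m + r + 2 by ring, sum_wordsOfLength_add_two]
    refine sum_congr rfl fun a _ => sum_congr rfl fun b _ => ?_
    split_ifs with hab
    · rw [hittingPoly, mul_sum]
      refine sum_congr rfl fun w hw => ?_
      rw [mem_wordsOfLength] at hw
      rw [mul_ite, mul_zero, holeWeight_cons_append]
      exact if_congr ((isExcursion_cons_append hm a b (by omega)).trans (and_iff_right hab)) rfl rfl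
    · refine sum_eq_zero fun w hw => if_neg fun h => hab ?_
      rw [mem_wordsOfLength] at hw
      exact ((isExcursion_cons_append hm a b (by omega)).1 h).1
  rw [key]
  simp [Fintype.sum_option, holeWeight]

theorem sum_isLeast_hasAbelianBorder (r k : ℕ) (hk : 2 ≤ k)
    [DecidablePred fun w : PWord (Fin 2) => IsLeast {i | HasAbelianBorder w i} k] :
    ∑ w ∈ wordsOfLength (Option (Fin 2)) (2 * k + r),
      (if IsLeast {i | HasAbelianBorder w i} k then holeWeight w else 0) =
    C (2 * (catalan (k - 1) : ℤ)) * ((1 + X) ^ k * (X + C 2) ^ r) := by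
  classical
  have h₁ : ∀ w ∈ wordsOfLength (Option (Fin 2)) (2 * k + r),
      (if IsLeast {i | HasAbelianBorder w i} k then holeWeight w else 0) =
      (if IsExcursion k w then holeWeight w else 0) +
        (if IsExcursion k w.reverse then holeWeight w.reverse else 0) := by
    intro w hw
    rw [mem_wordsOfLength] at hw
    have hr : holeWeight w.reverse = holeWeight w := by simp [holeWeight]
    rw [hr, if_congr (isLeast_hasAbelianBorder_iff hk (by omega)) rfl rfl]
    by_cases h : IsExcursion k w
    · simp [h, h.not_reverse hk]
    · simp [h]
  rw [sum_congr rfl h₁, sum_add_distrib,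
    sum_wordsOfLength_reverse _ fun w => if IsExcursion k w then holeWeight w else 0]
  obtain ⟨m, rfl⟩ : ∃ m, k = m + 1 + 1 := ⟨k - 2, by omega⟩
  have h₂ := hittingPoly_eq r m 1
  rw [Nat.cast_one, ballotNumber_one] at h₂
  rw [sum_isExcursion r (m + 1) (by omega), h₂, Nat.add_sub_cancel, C_mul, map_ofNat]
  ring

theorem natCard_eq_coeff (n h : ℕ) (P : PWord (Fin 2) → Prop) [DecidablePred P] :
    (Nat.card {w : PWord (Fin 2) // w.length = n ∧ w.countP (·.isNone) = h ∧ P w} : ℤ) =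
      (∑ w ∈ wordsOfLength (Option (Fin 2)) n, if P w then holeWeight w else 0).coeff h := by
  have h₁ : Nat.card {w : PWord (Fin 2) // w.length = n ∧ w.countP (·.isNone) = h ∧ P w} =
      #{w ∈ wordsOfLength (Option (Fin 2)) n | w.countP (·.isNone) = h ∧ P w} :=
    Nat.subtype_card _ (by simp)
  rw [h₁, finsetSum_coeff, card_filter, Nat.cast_sum]
  refine sum_congr rfl fun w _ => ?_
  by_cases hP : P w <;> simp [hP, holeWeight, coeff_X_pow, eq_comm]

theorem natCard_isLeast_hasAbelianBorder (r k h : ℕ) (hk : 2 ≤ k) :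
    Nat.card {w : PWord (Fin 2) // w.length = 2 * k + r ∧ w.countP (·.isNone) = h ∧
        IsLeast {i | HasAbelianBorder w i} k} =
      ∑ j ∈ range (h + 1),
        2 * k.choose j * catalan (k - 1) * r.choose (h - j) * 2 ^ (r - (h - j)) := by
  classical
  rw [← Nat.cast_inj (R := ℤ), natCard_eq_coeff, sum_isLeast_hasAbelianBorder r k hk,
    coeff_C_mul, coeff_mul, Nat.sum_antidiagonal_eq_sum_range_succ_mk, mul_sum, Nat.cast_sum]
  refine sum_congr rfl fun j _ => ?_
  rw [coeff_one_add_X_pow, coeff_X_add_C_pow]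
  push_cast
  ring

/-- For `k ≥ 2` and `0 ≤ j ≤ k`, the number of binary partial words of length `2k`
with exactly `j` holes and minimal abelian border length `k` is
`2 * binom(k,j) * C_{k-1}`; consequently, for `n ≥ 2k` and `0 ≤ h ≤ n`, the number
of binary partial words of length `n` with exactly `h` holes and minimal abelian
border length `k` is
`∑_{j=0}^{h} 2 * binom(k,j) * C_{k-1} * binom(n-2k, h-j) * 2^(n-2k-(h-j))`. -/
theorem stmt_8 (k : ℕ) (hk : 2 ≤ k) :
    (∀ j ≤ k,
      Nat.card {u : PWord (Fin 2) // u.length = 2 * k ∧ u.countP (·.isNone) = j ∧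
          IsLeast {i | HasAbelianBorder u i} k} =
        2 * k.choose j * catalan (k - 1)) ∧
    ∀ n h, 2 * k ≤ n → h ≤ n →
      Nat.card {w : PWord (Fin 2) // w.length = n ∧ w.countP (·.isNone) = h ∧
          IsLeast {i | HasAbelianBorder w i} k} =
        ∑ j ∈ Finset.range (h + 1),
          2 * k.choose j * catalan (k - 1) *
            (n - 2 * k).choose (h - j) * 2 ^ (n - 2 * k - (h - j)) := by
  have main := fun r h => natCard_isLeast_hasAbelianBorder r k h hk
  refine ⟨fun j _ => ?_, fun n h hn _ => ?_⟩
  · rw [← Nat.add_zero (2 * k), main, sum_eq_single j]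
    · simp
    · intro i hi hij
      rw [mem_range] at hi
      rw [Nat.choose_eq_zero_of_lt (show 0 < j - i by omega)]
      simp
    · simp
  · obtain ⟨r, rfl⟩ := Nat.exists_eq_add_of_le hn
    rw [main, Nat.add_sub_cancel_left]
end

section
/- Let w be a partial word of length n over a nonempty alphabet Σ with exactly h holes, where 0 ≤ h < n. Then for every i with 1 ≤ i ≤ h, w has an abelian border of length n−i; in particular, w has at least h distinct abelian borders. -/
theorem List.length_reduceOption_add_countP_isNone {α : Type*} (w : List (Option α)) :
    w.reduceOption.length + w.countP (·.isNone) = w.length := by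
  induction w with
  | nil => simp
  | cons o w ih => cases o <;> simp <;> omega

/-- Filling the holes of `w` with the letters of `m`. -/
theorem exists_isCompletion_perm_append {α : Type*} (w : PWord α) (m : List α)
    (hm : m.length = w.countP (·.isNone)) :
    ∃ c, IsCompletion w c ∧ c.Perm (w.reduceOption ++ m) := by
  induction w generalizing m with
  | nil => exact ⟨[], List.Forall₂.nil, by simp_all⟩
  | cons o w ih =>
    cases o with
    | none =>
      cases m with
      | nil => simp at hm
      | cons a m =>
        obtain ⟨c, hc, hp⟩ := ih m (by simpa using hm)
        refine ⟨a :: c, List.Forall₂.cons (by simp) hc, ?_⟩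
        simpa using (hp.cons a).trans List.perm_middle.symm
    | some b =>
      obtain ⟨c, hc, hp⟩ := ih m (by simpa using hm)
      exact ⟨b :: c, List.Forall₂.cons (by simp) hc, by simpa using hp⟩

theorem exists_isCompletion_perm {α : Type*} (w : PWord α) (l : List α)
    (hsub : w.reduceOption.Sublist l) (hl : l.length = w.length) :
    ∃ c, IsCompletion w c ∧ c.Perm l := by
  obtain ⟨m, hm⟩ := hsub.exists_perm_append
  have h₁ := hm.length_eq
  have h₂ := w.length_reduceOption_add_countP_isNone
  rw [List.length_append] at h₁
  obtain ⟨c, hc, hp⟩ := exists_isCompletion_perm_append w m (by omega)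
  exact ⟨c, hc, hp.trans hm.symm⟩

/-- Two sublists of `w` of the same length `k` are abelian compatible as soon as `w` has at most
`k` letters that are not holes. -/
theorem abelianCompat_of_sublist {α : Type*} [Nonempty α] {w u v : PWord α}
    (hu : u.Sublist w) (hv : v.Sublist w) (huv : u.length = v.length)
    (hw : w.reduceOption.length ≤ u.length) : AbelianCompat u v := by
  obtain ⟨a⟩ := ‹Nonempty α›
  let l := w.reduceOption ++ List.replicate (u.length - w.reduceOption.length) a
  have hl : l.length = u.length := by
    simp only [l, List.length_append, List.length_replicate]
    omega
  have hsub {p : PWord α} (hp : p.Sublist w) : p.reduceOption.Sublist l :=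
    (hp.filterMap id).trans (List.sublist_append_left _ _)
  obtain ⟨cu, hcu, hpu⟩ := exists_isCompletion_perm u l (hsub hu) hl
  obtain ⟨cv, hcv, hpv⟩ := exists_isCompletion_perm v l (hsub hv) (hl.trans huv)
  exact ⟨cu, cv, hcu, hcv, hpu.trans hpv.symm⟩

/-- A partial word of length `n` over a nonempty alphabet with exactly `h` holes,
`0 ≤ h < n`, has an abelian border of length `n - i` for every `1 ≤ i ≤ h`;
in particular it has at least `h` distinct abelian borders. -/
theorem stmt_9 {α : Type*} [Nonempty α] (w : PWord α) (n h : ℕ)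
    (hlen : w.length = n) (hholes : w.countP (·.isNone) = h) (hh : h < n) :
    (∀ i, 1 ≤ i → i ≤ h → HasAbelianBorder w (n - i)) ∧
      h ≤ Nat.card {k // HasAbelianBorder w k} := by
  have hborder : ∀ i, 1 ≤ i → i ≤ h → HasAbelianBorder w (n - i) := by
    intro i hi hih
    have hcount := w.length_reduceOption_add_countP_isNone
    refine ⟨by omega, by omega, abelianCompat_of_sublist (List.take_sublist _ _)
      (List.drop_sublist _ _) ?_ ?_⟩
    · simp only [List.length_take, List.length_drop]
      omega
    · rw [List.length_take]
      omega
  refine ⟨hborder, ?_⟩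
  have : Finite {k // HasAbelianBorder w k} :=
    ((Set.finite_Iic (w.length - 1)).subset fun _ hk => hk.2.1).to_subtype
  let f : Fin h → {k // HasAbelianBorder w k} := fun i =>
    ⟨n - (i + 1), hborder (i + 1) (by omega) (by omega)⟩
  have hf : Function.Injective f := by
    intro i j hij
    have := congrArg Subtype.val hij
    simp only [f] at this
    omega
  simpa using Nat.card_le_card_of_injective f hf
end

section
/- Let n ≥ 4 be even and let w be a binary partial word of length n with exactly one hole, located at a position i with 0 ≤ i ≤ n/2 − 1, whose minimal abelian border length equals n−1. If w[0] = 0, then w[n−2] = w[n−1] = 1. Consequently, if in addition w is unique (its first non-hole character is 0) and w = uv with |u| = |v| = n/2, then the number of 0s in u is strictly greater than the number of 0s in v, and the number of 1s in u is strictly less than the number of 1s in v minus 1. -/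
/-- The first non-hole character of the binary partial word `w` is the letter `0`:
some position `j` holds the letter `0` and all earlier positions are holes. -/
def FirstLetterIsZero (w : PWord (Fin 2)) : Prop :=
  ∃ j, (∀ l, l < j → w.getD l none = none) ∧ w.getD j none = some 0

/-- Every admissible number of zeros is realised by some completion. -/
theorem exists_isCompletion_count_zero (w : PWord (Fin 2)) (m : ℕ)
    (h₁ : w.count (some 0) ≤ m) (h₂ : m ≤ w.count (some 0) + w.countP (·.isNone)) :
    ∃ c : List (Fin 2), IsCompletion w c ∧ c.count 0 = m := by
  induction w generalizing m with
  | nil => exact ⟨[], List.Forall₂.nil, by simp at h₂; simp [h₂]⟩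
  | cons o w ih =>
    rcases o with _ | x
    · simp only [List.count_cons, List.countP_cons] at h₁ h₂
      simp at h₁ h₂
      by_cases hm : m = w.count (some 0)
      · obtain ⟨c, hc, hcm⟩ := ih m (by omega) (by omega)
        exact ⟨1 :: c, List.Forall₂.cons (by simp) hc, by simp [hcm]⟩
      · obtain ⟨c, hc, hcm⟩ := ih (m - 1) (by omega) (by omega)
        exact ⟨0 :: c, List.Forall₂.cons (by simp) hc, by simp [hcm]; omega⟩
    · fin_cases x
      · simp at h₁ h₂
        obtain ⟨c, hc, hcm⟩ := ih (m - 1) (by omega) (by omega)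
        exact ⟨0 :: c, List.Forall₂.cons (by simp) hc, by simp [hcm]; omega⟩
      · simp at h₁ h₂
        obtain ⟨c, hc, hcm⟩ := ih m (by omega) (by omega)
        exact ⟨1 :: c, List.Forall₂.cons (by simp) hc, by simp [hcm]⟩

theorem count_zero_add_count_one_s13 (l : List (Fin 2)) : l.count 0 + l.count 1 = l.length := by
  induction l with
  | nil => simp
  | cons x l ih => fin_cases x <;> simp <;> omega

theorem perm_of_count_zero_eq {l₁ l₂ : List (Fin 2)} (hl : l₁.length = l₂.length)
    (h : l₁.count 0 = l₂.count 0) : l₁.Perm l₂ := by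
  have h₁ := count_zero_add_count_one_s13 l₁
  have h₂ := count_zero_add_count_one_s13 l₂
  refine List.perm_iff_count.2 fun x => ?_
  fin_cases x
  · exact h
  · simp; omega

theorem abelianCompat_of_count_le {u v : PWord (Fin 2)} (hl : u.length = v.length)
    (h₁ : u.count (some 0) ≤ v.count (some 0) + v.countP (·.isNone))
    (h₂ : v.count (some 0) ≤ u.count (some 0) + u.countP (·.isNone)) : AbelianCompat u v := by
  obtain ⟨c, hc, hcm⟩ := exists_isCompletion_count_zero u
    (max (u.count (some 0)) (v.count (some 0))) (by omega) (by omega)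
  obtain ⟨d, hd, hdm⟩ := exists_isCompletion_count_zero v
    (max (u.count (some 0)) (v.count (some 0))) (by omega) (by omega)
  refine ⟨c, d, hc, hd, perm_of_count_zero_eq ?_ (hcm.trans hdm.symm)⟩
  rw [← List.Forall₂.length_eq hc, ← List.Forall₂.length_eq hd, hl]

theorem count_zero_add_count_one_add_holes (w : PWord (Fin 2)) :
    w.count (some 0) + w.count (some 1) + w.countP (·.isNone) = w.length := by
  induction w with
  | nil => simp
  | cons o w ih =>
    rcases o with _ | x
    · simp; omega
    · fin_cases x <;> simp <;> omega

/-- If a binary partial word starts with `0` and has no short abelian border, then every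
completion of a short prefix has more zeros than every completion of the suffix of the
same length. -/
theorem count_zero_suffix_lt_prefix {w : PWord (Fin 2)} (h₀ : w.getD 0 none = some 0) {N : ℕ}
    (hN : N < w.length) (hb : ∀ k ≤ N, ¬ HasAbelianBorder w k) {k : ℕ} (hk₁ : 1 ≤ k)
    (hk : k ≤ N) :
    (w.drop (w.length - k)).count (some 0) + (w.drop (w.length - k)).countP (·.isNone) <
      (w.take k).count (some 0) := by
  have key : ∀ j, 1 ≤ j → j ≤ N →
      (w.drop (w.length - j)).count (some 0) + (w.drop (w.length - j)).countP (·.isNone) ≤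
        (w.take j).count (some 0) →
      (w.drop (w.length - j)).count (some 0) + (w.drop (w.length - j)).countP (·.isNone) <
        (w.take j).count (some 0) := by
    intro j hj₁ hj hle
    by_contra! hlt
    refine hb j hj ⟨hj₁, by omega, abelianCompat_of_count_le ?_ hlt (by omega)⟩
    simp; omega
  have step : ∀ j, j + 1 ≤ w.length →
      (w.drop (w.length - (j + 1))).count (some 0) +
          (w.drop (w.length - (j + 1))).countP (·.isNone) ≤
        (w.drop (w.length - j)).count (some 0) +
          (w.drop (w.length - j)).countP (·.isNone) + 1 := by
    intro j hj
    have hd := List.drop_eq_getElem_cons (l := w) (i := w.length - (j + 1)) (by omega)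
    rw [show w.length - (j + 1) + 1 = w.length - j by omega] at hd
    rw [hd, List.count_cons, List.countP_cons]
    rcases w[w.length - (j + 1)] with _ | x
    · simp; omega
    · simp; split <;> omega
  induction k, hk₁ using Nat.le_induction with
  | base =>
    refine key 1 le_rfl hk ((step 0 (by omega)).trans ?_)
    rcases w with _ | ⟨a, w⟩
    · simp at h₀
    · simp at h₀
      simp [h₀]
  | succ j hj ih =>
    have hlt := ih (by omega)
    have hmono : (w.take j).count (some 0) ≤ (w.take (j + 1)).count (some 0) :=
      (List.take_sublist_take_left (by omega)).count_le _
    exact key _ (by omega) hk (by have := step j (by omega); omega)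

theorem one_le_holes_take {w : PWord (Fin 2)} {i m : ℕ} (him : i < m)
    (h : w.getD i (some 0) = none) : 1 ≤ (w.take m).countP (·.isNone) := by
  have hi : i < w.length := by
    by_contra! hi
    rw [List.getD_eq_default _ _ hi] at h
    exact absurd h (by simp)
  rw [List.getD_eq_getElem _ _ hi] at h
  refine List.countP_pos_iff.2 ⟨none, ?_, rfl⟩
  rw [← h, List.mem_take_iff_getElem]
  exact ⟨i, by omega, rfl⟩

/-- Let `n ≥ 4` be even and let `w` be a binary partial word of length `n` with
exactly one hole, located at a position `i ≤ n/2 - 1`, whose minimal abelian border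
length is `n - 1`. If `w[0] = 0` then `w[n-2] = w[n-1] = 1`. Consequently, if
moreover the first non-hole character of `w` is `0` and `w = uv` with
`|u| = |v| = n/2`, then `|u|₀ > |v|₀` and `|u|₁ < |v|₁ - 1`. -/
theorem stmt_13 (n : ℕ) (hn : 4 ≤ n) (he : Even n) (w : PWord (Fin 2))
    (hlen : w.length = n) (hhole : w.countP (·.isNone) = 1)
    (hpos : ∃ i, i ≤ n / 2 - 1 ∧ w.getD i (some 0) = none)
    (hmin : IsLeast {k | HasAbelianBorder w k} (n - 1)) :
    (w.getD 0 none = some 0 →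
      w.getD (n - 2) none = some 1 ∧ w.getD (n - 1) none = some 1) ∧
    (FirstLetterIsZero w →
      ∀ u v : PWord (Fin 2), w = u ++ v → u.length = n / 2 → v.length = n / 2 →
        v.count (some 0) < u.count (some 0) ∧
          u.count (some 1) + 1 < v.count (some 1)) := by
  obtain ⟨i, hi, hin⟩ := hpos
  have hb : ∀ k ≤ n - 2, ¬ HasAbelianBorder w k := fun k hk hbk => by
    have := hmin.2 hbk
    omega
  have hsep : w.getD 0 none = some 0 → ∀ k, 1 ≤ k → k ≤ n - 2 → _ := fun h₀ k hk₁ hk =>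
    count_zero_suffix_lt_prefix h₀ (by omega) hb hk₁ hk
  rw [hlen] at hsep
  have htake : 1 ≤ (w.take (n / 2)).countP (·.isNone) := one_le_holes_take (by omega) hin
  have hsplit : ∀ m, (w.take m).countP (·.isNone) + (w.drop m).countP (·.isNone) = 1 := by
    intro m
    rw [← List.countP_append, List.take_append_drop, hhole]
  constructor
  · intro h₀
    have h₂ := hsep h₀ 2 (by omega) (by omega)
    have hlast := hsep h₀ (n - 2) (by omega) le_rfl
    have hholes : (w.drop (n - 2)).countP (·.isNone) = 0 := by
      have hmono : (w.take (n / 2)).countP (·.isNone) ≤ (w.take (n - 2)).countP (·.isNone) :=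
        (List.take_sublist_take_left (by omega)).countP_le
      have := hsplit (n - 2)
      omega
    have hzeros : (w.drop (n - 2)).count (some 0) = 0 := by
      rw [show n - (n - 2) = 2 by omega] at hlast
      have hc₁ : (w.take 2).count (some 0) + (w.drop 2).count (some 0) =
          (w.take (n - 2)).count (some 0) + (w.drop (n - 2)).count (some 0) := by
        rw [← List.count_append, ← List.count_append, List.take_append_drop,
          List.take_append_drop]
      have hc₂ := count_zero_add_count_one_add_holes (w.take 2)
      have hc₃ := hsplit 2
      have hc₄ : (w.take 2).length = 2 := by simp; omega
      omega
    have hone : ∀ x ∈ w.drop (n - 2), x = some 1 := by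
      intro x hx
      rcases x with _ | x
      · simp [List.countP_eq_zero] at hholes
        exact absurd rfl (hholes _ hx)
      · fin_cases x
        · exact absurd hx (List.count_eq_zero.1 hzeros)
        · rfl
    have hget : ∀ j, n - 2 ≤ j → j < n → w.getD j none = some 1 := by
      intro j hj₁ hj
      rw [List.getD_eq_getElem _ _ (by omega)]
      refine hone _ (List.mem_drop_iff_getElem.2 ⟨j - (n - 2), by omega, ?_⟩)
      congr 1
      omega
    exact ⟨hget _ le_rfl (by omega), hget _ (by omega) (by omega)⟩
  · rintro ⟨j, hj, hj0⟩ u v rfl hu hv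
    have h₀ : (u ++ v).getD 0 none = some 0 := by
      rcases Nat.eq_zero_or_pos j with rfl | hjpos
      · exact hj0
      · have hhole₀ := one_le_holes_take (w := u ++ v) (i := 0) (m := 1) one_pos (by
          have := hj 0 hjpos
          rw [List.getD_eq_getElem _ _ (by omega)] at this ⊢
          exact this)
        have hl₁ : ((u ++ v).take 1).length = 1 := by rw [List.length_take]; omega
        have hl₂ : ((u ++ v).drop ((u ++ v).length - 1)).length = 1 := by
          rw [List.length_drop]; omega
        have hc₁ := count_zero_add_count_one_add_holes ((u ++ v).take 1)
        have hc₂ := count_zero_add_count_one_add_holes ((u ++ v).drop ((u ++ v).length - 1))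
        exact absurd ⟨le_rfl, by omega,
          abelianCompat_of_count_le (by omega) (by omega) (by omega)⟩ (hb 1 (by omega))
    have hn2 : n - n / 2 = n / 2 := by
      obtain ⟨r, rfl⟩ := he
      omega
    have h := hsep h₀ (n / 2) (by omega) (by omega)
    have hs := hsplit (n / 2)
    rw [hn2, List.take_left' hu, List.drop_left' hu] at h
    rw [List.take_left' hu, List.drop_left' hu] at hs
    rw [List.take_left' hu] at htake
    have h₁ := count_zero_add_count_one_add_holes u
    have h₂ := count_zero_add_count_one_add_holes v
    omega
end
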